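/- arXiv:2509.20018 — 3 statements merged into one kernel-verified Lean document; each statement's English description precedes it below -/
import Mathlib

section
/- (Krasnosel'skiĭ–Precup fixed point theorem, homotopy conditions) Let K₁, K₂ be cones in normed linear spaces X, Y, K = K₁ × K₂, and let r = (r₁,r₂), R = (R₁,R₂) with 0 < rᵢ < Rᵢ (i = 1,2). Assume T = (T₁,T₂) : K̄_{r,R} → K is a compact map and for each i ∈ {1,2} there exists hᵢ ∈ Kᵢ \ {0} such that one of the following holds for all x = (x₁,x₂) ∈ K̄_{r,R}: (a) Tᵢx + μhᵢ ≠ xᵢ whenever ‖xᵢ‖ = rᵢ and μ > 0, and Tᵢx ≠ λxᵢ whenever ‖xᵢ‖ = Rᵢ and λ > 1; or (b) Tᵢx ≠ λxᵢ whenever ‖xᵢ‖ = rᵢ and λ > 1, and Tᵢx + μhᵢ ≠ xᵢ whenever ‖xᵢ‖ = Rᵢ and μ > 0. Then T has at least one fixed point x̄ = (x̄₁,x̄₂) ∈ K with rᵢ ≤ ‖x̄ᵢ‖ ≤ Rᵢ for i = 1,2. -/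
open Set

/-- A cone in a normed linear space: a nonempty closed convex set, invariant under
multiplication by nonnegative scalars, with `K ∩ (-K) = {0}`. -/
def IsCone {X : Type*} [NormedAddCommGroup X] [NormedSpace ℝ X] (K : Set X) : Prop :=
  K.Nonempty ∧ IsClosed K ∧ Convex ℝ K ∧
    (∀ u ∈ K, ∀ c : ℝ, 0 ≤ c → c • u ∈ K) ∧ K ∩ (-K) = {0}

/-- The set `K̄_{r,R} = {(x₁,x₂) ∈ K₁ × K₂ : rᵢ ≤ ‖xᵢ‖ ≤ Rᵢ}`. -/
def KrR {X Y : Type*} [NormedAddCommGroup X] [NormedAddCommGroup Y]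
    (K₁ : Set X) (K₂ : Set Y) (r₁ r₂ R₁ R₂ : ℝ) : Set (X × Y) :=
  {p | p.1 ∈ K₁ ∧ p.2 ∈ K₂ ∧ r₁ ≤ ‖p.1‖ ∧ ‖p.1‖ ≤ R₁ ∧ r₂ ≤ ‖p.2‖ ∧ ‖p.2‖ ≤ R₂}

/-- A set of points `σ` and a set of criteria `C` are in dominant position if no point beats, for
every criterion in `C`, some point of `σ`. -/
def Dominant {T I : Type*} (u : T → I → ℕ) (σ : Finset I) (C : Finset T) : Prop :=
  ∀ y, ∃ i ∈ C, ∀ x ∈ σ, u i y ≤ u i x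

/-- The pair `d` is a door of the room `ρ`: it arises from `ρ` by adding a criterion or by
removing a point. -/
def IsDoorOf {T I : Type*} [DecidableEq T] [DecidableEq I] (d ρ : Finset I × Finset T) : Prop :=
  (ρ.1 = d.1 ∧ ∃ k ∈ d.2, ρ.2 = d.2.erase k) ∨ (ρ.2 = d.2 ∧ ∃ y ∉ d.1, ρ.1 = insert y d.1)

lemma Dominant.mono {T I : Type*} {u : T → I → ℕ} {σ τ : Finset I} {C D : Finset T}
    (h : Dominant u σ C) (hσ : τ ⊆ σ) (hC : C ⊆ D) : Dominant u τ D := fun y ↦ by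
  obtain ⟨i, hi, h'⟩ := h y
  exact ⟨i, hC hi, fun x hx ↦ h' x (hσ hx)⟩

lemma IsDoorOf.dominant {T I : Type*} [DecidableEq T] [DecidableEq I] {u : T → I → ℕ}
    {d ρ : Finset I × Finset T} (h : IsDoorOf d ρ) (hρ : Dominant u ρ.1 ρ.2) :
    Dominant u d.1 d.2 := by
  rcases h with ⟨h1, k, hk, h2⟩ | ⟨h1, y, hy, h2⟩
  · exact hρ.mono h1.ge (h2 ▸ Finset.erase_subset _ _)
  · exact hρ.mono (h2 ▸ Finset.subset_insert _ _) h1.le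

/-- If a map on a finite set misses injectivity by one, exactly two points can be removed without
changing the image. -/
lemma card_filter_image_erase_eq_two {α β : Type*} [DecidableEq α] [DecidableEq β]
    (s : Finset α) (f : α → β) (h : s.card = (s.image f).card + 1) :
    (s.filter fun y ↦ (s.erase y).image f = s.image f).card = 2 := by
  obtain ⟨a, ha, b, hb, hab, hf⟩ := Finset.exists_ne_map_eq_of_card_lt_of_maps_to
    (s := s) (t := s.image f) (f := f) (by omega) (fun x hx ↦ by
      simpa using ⟨x, hx, rfl⟩)
  have key : ∀ a ∈ s, ∀ b ∈ s, a ≠ b → f a = f b → (s.erase a).image f = s.image f := by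
    intro a ha b hb hab hf
    refine (Finset.image_subset_image (Finset.erase_subset _ _)).antisymm fun z hz ↦ ?_
    obtain ⟨x, hx, rfl⟩ := Finset.mem_image.1 hz
    by_cases hxa : x = a
    · exact Finset.mem_image.2 ⟨b, Finset.mem_erase.2 ⟨hab.symm, hb⟩, by rw [hxa, hf]⟩
    · exact Finset.mem_image_of_mem _ (Finset.mem_erase.2 ⟨hxa, hx⟩)
  have inj : Set.InjOn f (s.erase a) := by
    apply Finset.card_image_iff.1
    rw [key a ha b hb hab hf, Finset.card_erase_of_mem ha]
    omega
  rw [Finset.card_eq_two]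
  refine ⟨a, b, hab, ?_⟩
  ext y
  simp only [Finset.mem_filter, Finset.mem_insert, Finset.mem_singleton]
  constructor
  · rintro ⟨hy, hy'⟩
    by_contra! hne
    obtain ⟨z, hz, hzy⟩ := Finset.mem_image.1 (hy' ▸ Finset.mem_image_of_mem f hy)
    rw [Finset.mem_erase] at hz
    by_cases hza : z = a
    · exact hne.2 (inj (by simp [hne.1, hy]) (by simp [hab.symm, hb]) (by rw [← hzy, hza, hf]))
    · exact hz.1 (inj (by simp [hza, hz.2]) (by simp [hne.1, hy]) hzy)
  · rintro (rfl | rfl)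
    · exact ⟨ha, key _ ha b hb hab hf⟩
    · exact ⟨hb, key _ hb a ha hab.symm hf.symm⟩

section Scarf

variable {T I : Type*} [DecidableEq T] [DecidableEq I] {u : T → I → ℕ}

/-- The room `ρ` is entered through the door `(τ, D)` by giving up the criterion `k`. -/
def EnteredVia (u : T → I → ℕ) (τ : Finset I) (D : Finset T) (k : T)
    (ρ : Finset I × Finset T) : Prop :=
  ρ = (τ, D.erase k) ∨ ∃ y ∉ τ, ρ = (insert y τ, D) ∧ (∀ x ∈ τ, u k y < u k x) ∧
    ∀ l ∈ D, l ≠ k → ∃ x ∈ τ, u l x < u l y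

/-- Every point of `τ` is minimal for a criterion in `D` other than `k`. -/
def MinimalWithout (u : T → I → ℕ) (τ : Finset I) (D : Finset T) (k : T) : Prop :=
  ∀ x ∈ τ, ∃ l ∈ D, l ≠ k ∧ ∀ z ∈ τ, u l x ≤ u l z

lemma exists_enteredVia [Fintype I] (hu : ∀ i, Function.Injective (u i)) {τ : Finset I}
    {D : Finset T} {k : T}
    (hd : Dominant u τ D) (hk : MinimalWithout u τ D k) :
    ∃ ρ, EnteredVia u τ D k ρ ∧ Dominant u ρ.1 ρ.2 := by
  by_cases hM : (Finset.univ.filter fun y ↦ ∀ l ∈ D, l ≠ k → ∃ x ∈ τ, u l x < u l y).Nonempty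
  · obtain ⟨y, hy, hmax⟩ := Finset.exists_max_image _ (u k) hM
    simp only [Finset.mem_filter, Finset.mem_univ, true_and] at hy hmax
    have hyk : ∀ x ∈ τ, u k y ≤ u k x := by
      obtain ⟨l, hl, hl'⟩ := hd y
      by_cases hlk : l = k
      · exact hlk ▸ hl'
      · obtain ⟨x, hx, hxy⟩ := hy l hl hlk
        exact absurd (hl' x hx) (by omega)
    have hyτ : y ∉ τ := fun hyτ ↦ by
      obtain ⟨l, hl, hlk, hl'⟩ := hk y hyτ
      obtain ⟨x, hx, hxy⟩ := hy l hl hlk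
      exact absurd (hl' x hx) (by omega)
    refine ⟨(insert y τ, D), Or.inr ⟨y, hyτ, rfl, fun x hx ↦ lt_of_le_of_ne (hyk x hx)
      fun h ↦ hyτ (hu k h ▸ hx), hy⟩, fun z ↦ ?_⟩
    by_cases hz : ∀ l ∈ D, l ≠ k → ∃ x ∈ τ, u l x < u l z
    · obtain ⟨l, hl, hl'⟩ := hd z
      have hlk : l = k := by
        by_contra hlk
        obtain ⟨x, hx, hxy⟩ := hz l hl hlk
        exact absurd (hl' x hx) (by omega)
      subst hlk
      refine ⟨l, hl, fun x hx ↦ ?_⟩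
      rcases Finset.mem_insert.1 hx with rfl | hx
      · exact hmax z hz
      · exact hl' x hx
    · push Not at hz
      obtain ⟨l, hl, hlk, hl'⟩ := hz
      refine ⟨l, hl, fun x hx ↦ ?_⟩
      rcases Finset.mem_insert.1 hx with rfl | hx
      · obtain ⟨x', hx', h⟩ := hy l hl hlk
        exact (hl' x' hx').trans h.le
      · exact hl' x hx
  · refine ⟨(τ, D.erase k), Or.inl rfl, fun y ↦ ?_⟩
    by_contra! h
    exact hM ⟨y, by simpa using fun l hl hlk ↦ h l (Finset.mem_erase.2 ⟨hlk, hl⟩)⟩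

lemma EnteredVia.unique (hu : ∀ i, Function.Injective (u i)) {τ : Finset I} {D : Finset T} {k : T}
    {ρ ρ' : Finset I × Finset T} (h : EnteredVia u τ D k ρ) (h' : EnteredVia u τ D k ρ')
    (hρ : Dominant u ρ.1 ρ.2) (hρ' : Dominant u ρ'.1 ρ'.2) : ρ = ρ' := by
  have mixed : ∀ y, Dominant u τ (D.erase k) →
      (∀ l ∈ D, l ≠ k → ∃ x ∈ τ, u l x < u l y) → False := fun y hd hy ↦ by
    obtain ⟨l, hl, hl'⟩ := hd y
    rw [Finset.mem_erase] at hl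
    obtain ⟨x, hx, hxy⟩ := hy l hl.2 hl.1
    exact absurd (hl' x hx) (by omega)
  have two : ∀ y y', Dominant u (insert y τ) D →
      (∀ l ∈ D, l ≠ k → ∃ x ∈ τ, u l x < u l y') → u k y' ≤ u k y := fun y y' hd hy ↦ by
    obtain ⟨l, hl, hl'⟩ := hd y'
    by_cases hlk : l = k
    · exact hlk ▸ hl' y (Finset.mem_insert_self _ _)
    · obtain ⟨x, hx, hxy⟩ := hy l hl hlk
      exact absurd (hl' x (Finset.mem_insert_of_mem hx)) (by omega)
  rcases h with rfl | ⟨y, -, rfl, -, hy⟩ <;> rcases h' with rfl | ⟨y', -, rfl, -, hy'⟩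
  · rfl
  · exact (mixed y' hρ hy').elim
  · exact (mixed y hρ' hy).elim
  · rw [hu k ((two y' y hρ' hy).antisymm (two y y' hρ hy'))]

lemma exists_enteredVia_of_isDoorOf (hu : ∀ i, Function.Injective (u i)) {τ : Finset I}
    {D : Finset T} {ρ : Finset I × Finset T} (h : IsDoorOf (τ, D) ρ)
    (hρ : Dominant u ρ.1 ρ.2) (hcard : ρ.1.card = ρ.2.card) :
    ∃ k ∈ D, MinimalWithout u τ D k ∧ EnteredVia u τ D k ρ := by
  obtain ⟨σ, C⟩ := ρ
  rcases h with ⟨h1, k, hk, h2⟩ | ⟨h1, y, hy, h2⟩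
  · simp only at h1 hk h2 hρ
    subst h1 h2
    refine ⟨k, hk, fun x hx ↦ ?_, Or.inl rfl⟩
    obtain ⟨l, hl, hl'⟩ := hρ x
    rw [Finset.mem_erase] at hl
    exact ⟨l, hl.2, hl.1, hl'⟩
  · simp only at h1 hy h2 hρ hcard
    subst h1 h2
    choose f hf hf' using hρ
    have hinj : Set.InjOn f (insert y τ : Finset I) := fun a ha b hb hab ↦
      hu (f a) ((hf' a b hb).antisymm (hab ▸ hf' b a ha))
    have hsurj : (insert y τ).image f = C := by
      apply Finset.eq_of_subset_of_card_le
      · exact Finset.image_subset_iff.2 fun x _ ↦ hf x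
      · rw [Finset.card_image_of_injOn hinj, hcard]
    have hne : ∀ x ∈ τ, f x ≠ f y := fun x hx h ↦
      hy (hinj (by simp [hx]) (by simp) h ▸ hx)
    refine ⟨f y, hf y, fun x hx ↦ ⟨f x, hf x, hne x hx, fun z hz ↦
      hf' x z (Finset.mem_insert_of_mem hz)⟩, Or.inr ⟨y, hy, rfl, fun x hx ↦
      lt_of_le_of_ne (hf' y x (Finset.mem_insert_of_mem hx)) fun h ↦ hy (hu _ h ▸ hx),
      fun l hl hly ↦ ?_⟩⟩
    rw [← hsurj] at hl
    obtain ⟨x, hx, rfl⟩ := Finset.mem_image.1 hl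
    rcases Finset.mem_insert.1 hx with rfl | hx
    · exact absurd rfl hly
    · exact ⟨x, hx, lt_of_le_of_ne (hf' x y (by simp)) fun h ↦ hy (hu _ h ▸ hx)⟩

lemma EnteredVia.index_unique {τ : Finset I} {D : Finset T} {i j : T}
    {ρ : Finset I × Finset T} (hi : i ∈ D) (h : EnteredVia u τ D i ρ)
    (hj : j ∈ D) (h' : EnteredVia u τ D j ρ) : i = j := by
  rcases h with rfl | ⟨y, hy, rfl, hy1, hy2⟩ <;> rcases h' with h' | ⟨y', hy', h', hy1', hy2'⟩
  · rw [Prod.mk.injEq] at h'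
    by_contra hij
    have : i ∈ D.erase i := by
      rw [h'.2]
      exact Finset.mem_erase.2 ⟨hij, hi⟩
    exact Finset.notMem_erase i D this
  · rw [Prod.mk.injEq] at h'
    have : i ∈ D.erase i := by
      rw [h'.2]
      exact hi
    exact absurd this (Finset.notMem_erase i D)
  · rw [Prod.mk.injEq] at h'
    exact absurd (h'.2 ▸ hj) (Finset.notMem_erase j D)
  · rw [Prod.mk.injEq] at h'
    have hyy : y = y' := by
      have := h'.1 ▸ Finset.mem_insert_self y τ
      exact (Finset.mem_insert.1 this).resolve_right hy
    subst hyy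
    by_contra hij
    obtain ⟨x, hx, hxy⟩ := hy2' i hi hij
    exact absurd (hy1 x hx) (by omega)

open Classical in
lemma card_rooms_eq [Fintype T] [Fintype I] (hu : ∀ i, Function.Injective (u i))
    {τ : Finset I} {D : Finset T} (hd : Dominant u τ D) (hcard : D.card = τ.card + 1) :
    (Finset.univ.filter fun ρ : Finset I × Finset T ↦
      (Dominant u ρ.1 ρ.2 ∧ ρ.1.card = ρ.2.card) ∧ IsDoorOf (τ, D) ρ).card =
    (D.filter (MinimalWithout u τ D)).card := by
  symm
  have hex : ∀ k, MinimalWithout u τ D k → ∃ ρ, EnteredVia u τ D k ρ ∧ Dominant u ρ.1 ρ.2 :=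
    fun k hk ↦ exists_enteredVia hu hd hk
  choose F hF hF' using hex
  refine Finset.card_bij (fun k hk ↦ F k (Finset.mem_filter.1 hk).2) ?_ ?_ ?_
  · intro k hk
    have hkD := (Finset.mem_filter.1 hk).1
    have hk' := (Finset.mem_filter.1 hk).2
    simp only [Finset.mem_filter, Finset.mem_univ, true_and]
    have h := hF' k hk'
    rcases hF k hk' with h' | ⟨y, hy, h', -⟩
    · rw [h'] at h ⊢
      exact ⟨⟨h, by simp [Finset.card_erase_of_mem hkD, hcard]⟩, Or.inl ⟨rfl, k, hkD, rfl⟩⟩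
    · rw [h'] at h ⊢
      exact ⟨⟨h, by simp [Finset.card_insert_of_notMem hy, hcard]⟩, Or.inr ⟨rfl, y, hy, rfl⟩⟩
  · intro i hi j hj hij
    rw [Finset.mem_filter] at hi hj
    exact (hF i hi.2).index_unique hi.1 hj.1 (hij ▸ hF j hj.2)
  · intro ρ hρ
    simp only [Finset.mem_filter, Finset.mem_univ, true_and] at hρ
    obtain ⟨k, hkD, hk, h⟩ := exists_enteredVia_of_isDoorOf hu hρ.2 hρ.1.1 hρ.1.2
    exact ⟨k, Finset.mem_filter.2 ⟨hkD, hk⟩, (hF k hk).unique hu h (hF' k hk) hρ.1.1⟩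

open Classical in
lemma card_rooms_eq_two [Fintype T] [Fintype I] (hu : ∀ i, Function.Injective (u i))
    {τ : Finset I} {D : Finset T} (hd : Dominant u τ D) (hcard : D.card = τ.card + 1) (hτ : τ.Nonempty) :
    (Finset.univ.filter fun ρ : Finset I × Finset T ↦
      (Dominant u ρ.1 ρ.2 ∧ ρ.1.card = ρ.2.card) ∧ IsDoorOf (τ, D) ρ).card = 2 := by
  have hmin : ∀ l, ∃ x ∈ τ, ∀ z ∈ τ, u l x ≤ u l z := fun l ↦ Finset.exists_min_image τ (u l) hτ
  choose m hm hm' using hmin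
  have hiff : ∀ l, ∀ x ∈ τ, (∀ z ∈ τ, u l x ≤ u l z) → m l = x := fun l x hx h ↦
    hu l ((hm' l x hx).antisymm (h _ (hm l)))
  have himg : D.image m = τ := by
    refine (Finset.image_subset_iff.2 fun l _ ↦ hm l).antisymm fun x hx ↦ ?_
    obtain ⟨l, hl, hl'⟩ := hd x
    exact Finset.mem_image.2 ⟨l, hl, hiff l x hx hl'⟩
  rw [card_rooms_eq hu hd hcard, ← card_filter_image_erase_eq_two D m (by rw [himg, hcard])]
  congr 1
  refine Finset.filter_congr fun k hk ↦ ?_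
  rw [himg]
  constructor
  · intro h
    refine (Finset.image_subset_iff.2 fun l _ ↦ hm l).antisymm fun x hx ↦ ?_
    obtain ⟨l, hl, hlk, hl'⟩ := h x hx
    exact Finset.mem_image.2 ⟨l, Finset.mem_erase.2 ⟨hlk, hl⟩, hiff l x hx hl'⟩
  · intro h x hx
    rw [← h] at hx
    obtain ⟨l, hl, rfl⟩ := Finset.mem_image.1 hx
    rw [Finset.mem_erase] at hl
    exact ⟨l, hl.2, hl.1, hm' l⟩

open Classical in
lemma card_rooms_empty_eq_one [Fintype T] [Fintype I] [Nonempty I]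
    (hu : ∀ i, Function.Injective (u i)) (i : T) :
    (Finset.univ.filter fun ρ : Finset I × Finset T ↦
      (Dominant u ρ.1 ρ.2 ∧ ρ.1.card = ρ.2.card) ∧ IsDoorOf (∅, {i}) ρ).card = 1 := by
  rw [card_rooms_eq hu (fun y ↦ ⟨i, by simp, by simp⟩) (by simp)]
  rw [Finset.filter_true_of_mem fun k _ ↦ by simp [MinimalWithout]]
  simp

/-- A door whose points carry each of its criteria except `i` as a colour. -/
def AlmostColourful (c : I → T) (i : T) (d : Finset I × Finset T) : Prop :=
  i ∈ d.2 ∧ d.1.image c = d.2.erase i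

open Classical in
lemma even_card_doors [Fintype T] [Fintype I] (c : I → T) (i : T) {σ : Finset I} {C : Finset T}
    (hcard : σ.card = C.card) (hc : σ.image c ≠ C) :
    Even (Finset.univ.filter fun d : Finset I × Finset T ↦
      AlmostColourful c i d ∧ IsDoorOf d (σ, C)).card := by
  have hdoor : ∀ d : Finset I × Finset T, AlmostColourful c i d ∧ IsDoorOf d (σ, C) ↔
      i ∈ C ∧ ((∃ x ∉ C, σ.image c = insert x (C.erase i) ∧ d = (σ, insert x C)) ∨
        ∃ y ∈ σ, (σ.erase y).image c = C.erase i ∧ d = (σ.erase y, C)) := by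
    rintro ⟨τ, D⟩
    constructor
    · rintro ⟨⟨hi, h⟩, ⟨h1, k, hk, h2⟩ | ⟨h1, y, hy, h2⟩⟩
      · simp only at hi h h1 hk h2
        subst h1 h2
        have hki : k ≠ i := fun hki ↦ hc (hki ▸ h)
        refine ⟨by simp [hi, hki.symm], Or.inl ⟨k, by simp, ?_, by simp [hk]⟩⟩
        rw [h, Finset.erase_right_comm, Finset.insert_erase (by simp [hk, hki])]
      · simp only at hi h h1 hy h2
        subst h1 h2
        exact ⟨hi, Or.inr ⟨y, by simp, by simpa [hy] using h, by simp [hy]⟩⟩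
    · rintro ⟨hi, ⟨x, hx, h, hd⟩ | ⟨y, hy, h, hd⟩⟩
      · rw [Prod.mk.injEq] at hd
        obtain ⟨rfl, rfl⟩ := hd
        have hxi : x ≠ i := fun hxi ↦ hx (hxi ▸ hi)
        exact ⟨⟨by simp [hi], by simp [h, Finset.erase_insert_of_ne hxi]⟩,
          Or.inl ⟨rfl, x, by simp, by simp [hx]⟩⟩
      · rw [Prod.mk.injEq] at hd
        obtain ⟨rfl, rfl⟩ := hd
        exact ⟨⟨hi, h⟩, Or.inr ⟨rfl, y, by simp, by simp [hy]⟩⟩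
  simp only [hdoor]
  by_cases hi : i ∈ C
  swap
  · simp [hi]
  have hC : 0 < C.card := Finset.card_pos.2 ⟨i, hi⟩
  have hCe := Finset.card_erase_of_mem hi
  by_cases h1 : σ.image c = C.erase i
  · have h2 := card_filter_image_erase_eq_two σ c (by rw [h1, hCe]; omega)
    rw [h1] at h2
    have : (Finset.univ.filter fun d : Finset I × Finset T ↦
      i ∈ C ∧ ((∃ x ∉ C, σ.image c = insert x (C.erase i) ∧ d = (σ, insert x C)) ∨
        ∃ y ∈ σ, (σ.erase y).image c = C.erase i ∧ d = (σ.erase y, C))) =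
      (σ.filter fun y ↦ (σ.erase y).image c = C.erase i).image fun y ↦ (σ.erase y, C) := by
      ext d
      simp only [Finset.mem_filter, Finset.mem_univ, true_and, Finset.mem_image]
      constructor
      · rintro ⟨-, ⟨x, hx, h, -⟩ | ⟨y, hy, h, rfl⟩⟩
        · rw [h1] at h
          have : x ∈ C.erase i := by
            rw [h]
            exact Finset.mem_insert_self _ _
          exact absurd (Finset.mem_of_mem_erase this) hx
        · exact ⟨y, ⟨hy, h⟩, rfl⟩
      · rintro ⟨y, ⟨hy, h⟩, rfl⟩
        exact ⟨hi, Or.inr ⟨y, hy, h, rfl⟩⟩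
    rw [this, Finset.card_image_of_injOn, h2]
    · exact even_two
    · intro a ha b hb hab
      simp only [Finset.coe_filter, Set.mem_ofPred_eq] at ha hb
      rw [Prod.mk.injEq] at hab
      by_contra hne
      exact Finset.notMem_erase a σ (hab.1 ▸ Finset.mem_erase.2 ⟨hne, ha.1⟩)
  by_cases h3 : ∃ y ∈ σ, (σ.erase y).image c = C.erase i
  · obtain ⟨y, hy, h⟩ := h3
    have himg : σ.image c = insert (c y) (C.erase i) := by
      rw [← h, ← Finset.image_insert, Finset.insert_erase hy]
    have hcy : c y ∉ C := fun hcy ↦ by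
      by_cases hyi : c y = i
      · exact hc (by rw [himg, hyi, Finset.insert_erase hi])
      · exact h1 (by rw [himg, Finset.insert_eq_of_mem (Finset.mem_erase.2 ⟨hyi, hcy⟩)])
    have : (Finset.univ.filter fun d : Finset I × Finset T ↦
      i ∈ C ∧ ((∃ x ∉ C, σ.image c = insert x (C.erase i) ∧ d = (σ, insert x C)) ∨
        ∃ y ∈ σ, (σ.erase y).image c = C.erase i ∧ d = (σ.erase y, C))) =
      {(σ, insert (c y) C), (σ.erase y, C)} := by
      ext d
      simp only [Finset.mem_filter, Finset.mem_univ, true_and, Finset.mem_insert,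
        Finset.mem_singleton]
      constructor
      · rintro ⟨-, ⟨x, hx, h', rfl⟩ | ⟨z, hz, h', rfl⟩⟩
        · have := himg.symm.trans h' ▸ Finset.mem_insert_self (c y) (C.erase i)
          rcases Finset.mem_insert.1 this with rfl | h4
          · exact Or.inl rfl
          · exact absurd (Finset.mem_of_mem_erase h4) hcy
        · right
          by_cases hzy : z = y
          · rw [hzy]
          · have : c y ∈ (σ.erase z).image c :=
              Finset.mem_image_of_mem _ (Finset.mem_erase.2 ⟨Ne.symm hzy, hy⟩)
            rw [h'] at this
            exact absurd (Finset.mem_of_mem_erase this) hcy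
      · rintro (rfl | rfl)
        · exact ⟨hi, Or.inl ⟨c y, hcy, himg, rfl⟩⟩
        · exact ⟨hi, Or.inr ⟨y, hy, h, rfl⟩⟩
    rw [this, Finset.card_pair]
    · exact even_two
    · intro h'
      rw [Prod.mk.injEq] at h'
      exact Finset.notMem_erase y σ (h'.1 ▸ hy)
  · rw [Finset.filter_false_of_mem, Finset.card_empty]
    · exact Even.zero
    · rintro d - ⟨-, ⟨x, hx, h', rfl⟩ | ⟨z, hz, h', rfl⟩⟩
      · obtain ⟨y, hy, rfl⟩ := Finset.mem_image.1 (h' ▸ Finset.mem_insert_self x (C.erase i))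
        refine h3 ⟨y, hy, ?_⟩
        have hsub : C.erase i ⊆ (σ.erase y).image c := fun t ht ↦ by
          obtain ⟨z, hz, rfl⟩ := Finset.mem_image.1 (h' ▸ Finset.mem_insert_of_mem ht)
          refine Finset.mem_image_of_mem _ (Finset.mem_erase.2 ⟨?_, hz⟩)
          rintro rfl
          exact hx (Finset.mem_of_mem_erase ht)
        refine (Finset.eq_of_subset_of_card_le hsub ?_).symm
        refine Finset.card_image_le.trans ?_
        rw [Finset.card_erase_of_mem hy, hCe, hcard]
      · exact h3 ⟨z, hz, h'⟩

/-- **Scarf's lemma**: for every colouring of a finite set by criteria there is a dominant pair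
`(σ, C)` such that `C` is the set of colours of `σ`. -/
lemma exists_dominant_image_eq [Fintype T] [Fintype I] [Nonempty I] [Nonempty T]
    (hu : ∀ i, Function.Injective (u i)) (c : I → T) : ∃ σ : Finset I, Dominant u σ (σ.image c) := by
  classical
  obtain ⟨i⟩ := ‹Nonempty T›
  by_contra! hno
  let rooms := Finset.univ.filter fun ρ : Finset I × Finset T ↦
    Dominant u ρ.1 ρ.2 ∧ ρ.1.card = ρ.2.card
  let doors := Finset.univ.filter fun d : Finset I × Finset T ↦
    Dominant u d.1 d.2 ∧ AlmostColourful c i d ∧ d.2.card = d.1.card + 1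
  have hcount := Finset.sum_card_bipartiteAbove_eq_sum_card_bipartiteBelow
    (s := rooms) (t := doors) (fun ρ d ↦ IsDoorOf d ρ)
  have heven : Even (∑ ρ ∈ rooms,
      (Finset.bipartiteAbove (fun ρ d ↦ IsDoorOf d ρ) doors ρ).card) := by
    refine Finset.even_sum _ fun ρ hρ ↦ ?_
    simp only [rooms, Finset.mem_filter, Finset.mem_univ, true_and] at hρ
    have hc : ρ.1.image c ≠ ρ.2 := fun h ↦ hno ρ.1 (h ▸ hρ.1)
    suffices h : Finset.bipartiteAbove (fun ρ d ↦ IsDoorOf d ρ) doors ρ =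
        Finset.univ.filter fun d ↦ AlmostColourful c i d ∧ IsDoorOf d (ρ.1, ρ.2) by
      rw [h]
      exact even_card_doors c i hρ.2 hc
    ext d
    simp only [Finset.bipartiteAbove, doors, Finset.mem_filter, Finset.mem_univ, true_and]
    constructor
    · rintro ⟨⟨-, h1, -⟩, h2⟩
      exact ⟨h1, h2⟩
    · rintro ⟨h1, h2⟩
      refine ⟨⟨h2.dominant hρ.1, h1, ?_⟩, h2⟩
      have := hρ.2
      rcases h2 with ⟨h3, k, hk, h4⟩ | ⟨h3, y, hy, h4⟩
      · rw [h4, h3, Finset.card_erase_of_mem hk] at this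
        have := Finset.card_pos.2 ⟨k, hk⟩
        omega
      · rw [h4, h3, Finset.card_insert_of_notMem hy] at this
        exact this.symm
  have hbelow : ∀ d ∈ doors, (Finset.bipartiteBelow (fun ρ d ↦ IsDoorOf d ρ) rooms d) =
      Finset.univ.filter fun ρ : Finset I × Finset T ↦
      (Dominant u ρ.1 ρ.2 ∧ ρ.1.card = ρ.2.card) ∧ IsDoorOf d ρ := fun d _ ↦ by
    ext ρ
    simp [Finset.bipartiteBelow, rooms]
  have hmem : ((∅, {i}) : Finset I × Finset T) ∈ doors := by
    exact Finset.mem_filter.2 ⟨Finset.mem_univ _, fun y ↦ ⟨i, by simp, by simp⟩,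
      ⟨by simp, by simp⟩, by simp⟩
  rw [hcount, ← Finset.add_sum_erase _ _ hmem, hbelow _ hmem, card_rooms_empty_eq_one hu] at heven
  have hrest : Even (∑ d ∈ doors.erase (∅, {i}),
      (Finset.bipartiteBelow (fun ρ d ↦ IsDoorOf d ρ) rooms d).card) := by
    refine Finset.even_sum _ fun d hd ↦ ?_
    obtain ⟨hne, hd⟩ := Finset.mem_erase.1 hd
    rw [hbelow d hd]
    simp only [doors, Finset.mem_filter, Finset.mem_univ, true_and] at hd
    obtain ⟨τ, D⟩ := d
    obtain ⟨h1, ⟨h2, h3⟩, h4⟩ := hd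
    rw [card_rooms_eq_two hu h1 h4]
    · exact even_two
    · rw [Finset.nonempty_iff_ne_empty]
      rintro rfl
      simp only [Finset.card_empty, zero_add, Finset.card_eq_one] at h4 h2
      obtain ⟨a, rfl⟩ := h4
      rw [Finset.mem_singleton] at h2
      exact hne (by rw [h2])
  rw [Nat.even_add] at heven
  exact Nat.not_even_one (heven.2 hrest)

end Scarf

lemma exists_small_colourful {T : Type*} [Fintype T] [Nonempty T] (N : ℕ) (c : (T → ℕ) → T) :
    ∃ σ : Finset (T → ℕ), σ.Nonempty ∧ (∀ x ∈ σ, ∑ i, x i = N) ∧ ∀ x ∈ σ, ∀ i,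
      x i < Fintype.card T ∨
        (∃ y ∈ σ, c y = i) ∧ ∀ y ∈ σ, x i < y i + Fintype.card T := by
  classical
  let G : Finset (T → ℕ) := Finset.piAntidiag Finset.univ N
  have hG : ∀ x, x ∈ G ↔ ∑ i, x i = N := fun x ↦ by simp [G]
  obtain ⟨t⟩ := ‹Nonempty T›
  have ht : Pi.single t N ∈ G := by simp [hG]
  have : Nonempty G := ⟨⟨_, ht⟩⟩
  have : Nonempty T := ⟨t⟩
  let e := Fintype.equivFin G
  let u : T → G → ℕ := fun i x ↦ x.1 i * Fintype.card G + e x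
  have hu_le : ∀ i x y, u i y ≤ u i x → y.1 i ≤ x.1 i := fun i x y h ↦ by
    by_contra! hlt
    have h1 : (x.1 i + 1) * Fintype.card G ≤ y.1 i * Fintype.card G :=
      Nat.mul_le_mul_right _ hlt
    have h2 := (e x).2
    simp only [u] at h
    rw [add_mul] at h1
    omega
  have hu : ∀ i, Function.Injective (u i) := fun i x y h ↦ by
    have h1 : x.1 i = y.1 i := (hu_le i y x h.le).antisymm (hu_le i x y h.ge)
    simp only [u, h1, add_right_inj] at h
    exact e.injective (Fin.ext h)
  obtain ⟨σ, hσ⟩ := exists_dominant_image_eq hu (fun x : G ↦ c x.1)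
  set C := σ.image (fun x : G ↦ c x.1) with hC
  have hCne : C.Nonempty := by
    obtain ⟨i, hi, -⟩ := hσ ⟨_, ht⟩
    exact ⟨i, hi⟩
  have hσne : σ.Nonempty := Finset.image_nonempty.1 hCne
  have hmin : ∀ i, ∃ x ∈ σ, ∀ y ∈ σ, x.1 i ≤ y.1 i := fun i ↦
    Finset.exists_min_image σ (fun x : G ↦ x.1 i) hσne
  choose m hmσ hm using hmin
  have hsum : N < ∑ i ∈ C, ((m i).1 i + 1) := by
    by_contra! hle
    obtain ⟨i₀, hi₀⟩ := hCne
    let y : T → ℕ := fun i ↦ (if i ∈ C then (m i).1 i + 1 else 0) +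
      if i = i₀ then N - ∑ i ∈ C, ((m i).1 i + 1) else 0
    have hy : y ∈ G := by
      rw [hG]
      simp only [y, Finset.sum_add_distrib]
      simp only [Finset.sum_ite_mem, Finset.univ_inter, Finset.sum_ite_eq', Finset.mem_univ,
        if_true]
      rw [Finset.sum_add_distrib] at hle ⊢
      omega
    obtain ⟨i, hi, h⟩ := hσ ⟨y, hy⟩
    have h1 : y i ≤ (m i).1 i := hu_le i _ _ (h _ (hmσ i))
    simp only [y, hi, if_true] at h1
    omega
  have hCT : C.card ≤ Fintype.card T := Finset.card_le_univ C
  rw [Finset.sum_add_distrib, Finset.sum_const, smul_eq_mul, mul_one] at hsum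
  refine ⟨σ.image Subtype.val, hσne.image _, ?_, ?_⟩
  · intro x hx
    obtain ⟨x, -, rfl⟩ := Finset.mem_image.1 hx
    exact (hG _).1 x.2
  · intro x hx i
    obtain ⟨x, hxσ, rfl⟩ := Finset.mem_image.1 hx
    have hxN := (hG _).1 x.2
    have hle : ∀ S : Finset T, ∑ j ∈ S, (m j).1 j ≤ ∑ j ∈ S, x.1 j := fun S ↦
      Finset.sum_le_sum fun j _ ↦ hm j x hxσ
    by_cases hi : i ∈ C
    · right
      have h1 := Finset.add_sum_erase C (fun j ↦ (m j).1 j) hi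
      have h2 := Finset.add_sum_erase C x.1 hi
      have h3 := hle (C.erase i)
      have h4 : ∑ j ∈ C, x.1 j ≤ ∑ j, x.1 j := Finset.sum_le_univ_sum_of_nonneg (by simp)
      constructor
      · obtain ⟨y, hy, hyi⟩ := Finset.mem_image.1 hi
        exact ⟨y.1, Finset.mem_image_of_mem _ hy, hyi⟩
      · intro y hy
        obtain ⟨y, hyσ, rfl⟩ := Finset.mem_image.1 hy
        have h5 := hm i y hyσ
        omega
    · left
      have h1 := Finset.sum_insert (f := x.1) hi
      have h3 := hle C
      have h4 : ∑ j ∈ insert i C, x.1 j ≤ ∑ j, x.1 j :=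
        Finset.sum_le_univ_sum_of_nonneg (by simp)
      omega

lemma exists_forall_sub_le_of_mapsTo_stdSimplex {T : Type*} [Fintype T] [Nonempty T]
    {f : (T → ℝ) → T → ℝ} (hf : ContinuousOn f (stdSimplex ℝ T))
    (hmaps : MapsTo f (stdSimplex ℝ T) (stdSimplex ℝ T)) {ε : ℝ} (hε : 0 < ε) :
    ∃ z ∈ stdSimplex ℝ T, ∀ i, z i - f z i ≤ ε := by
  classical
  have huc := (isCompact_stdSimplex ℝ T).uniformContinuousOn_of_continuous hf
  rw [Metric.uniformContinuousOn_iff] at huc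
  obtain ⟨δ, hδ, huc⟩ := huc (ε / 2) (half_pos hε)
  set n : ℝ := (Fintype.card T : ℝ) with hn
  have hn0 : 0 < n := by
    rw [hn]
    exact_mod_cast Fintype.card_pos
  obtain ⟨N, hN⟩ := exists_nat_gt (max (n / δ) (n / (ε / 2)))
  rw [max_lt_iff] at hN
  have hN0 : (0 : ℝ) < N := (div_pos hn0 hδ).trans hN.1
  rw [div_lt_iff₀ hδ, div_lt_iff₀ (half_pos hε)] at hN
  have hNδ : n / N < δ := by rw [div_lt_iff₀ hN0]; linarith
  have hNε : n / N < ε / 2 := by rw [div_lt_iff₀ hN0]; linarith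
  let p : (T → ℕ) → T → ℝ := fun x i ↦ x i / N
  have hp : ∀ x : T → ℕ, ∑ i, x i = N → p x ∈ stdSimplex ℝ T := fun x hx ↦ by
    refine ⟨fun i ↦ by positivity, ?_⟩
    simp only [p]
    rw [← Finset.sum_div, ← Nat.cast_sum, hx, div_self hN0.ne']
  have hex : ∀ x : T → ℕ, ∃ i, ∑ i, x i = N → p x i ≤ f (p x) i := fun x ↦ by
    by_contra! h
    have hx := (h (Classical.arbitrary T)).1
    have hlt : ∑ i, f (p x) i < ∑ i, p x i :=
      Finset.sum_lt_sum_of_nonempty Finset.univ_nonempty fun i _ ↦ (h i).2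
    rw [(hmaps (hp x hx)).2, (hp x hx).2] at hlt
    exact lt_irrefl _ hlt
  choose c hc using hex
  obtain ⟨σ, ⟨x, hx⟩, hσN, hσ⟩ := exists_small_colourful N c
  have hdist : ∀ y ∈ σ, ∀ i, p x i < p y i + n / N := fun y hy i ↦ by
    simp only [p, ← add_div]
    rw [div_lt_div_iff_of_pos_right hN0, hn]
    rcases hσ x hx i with h | ⟨-, h⟩
    · exact_mod_cast h.trans_le (Nat.le_add_left _ _)
    · exact_mod_cast h y hy
  have hdist' : ∀ y ∈ σ, ∀ i, p y i < p x i + n / N := fun y hy i ↦ by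
    simp only [p, ← add_div]
    rw [div_lt_div_iff_of_pos_right hN0, hn]
    rcases hσ y hy i with h | ⟨-, h⟩
    · exact_mod_cast h.trans_le (Nat.le_add_left _ _)
    · exact_mod_cast h x hx
  refine ⟨p x, hp x (hσN x hx), fun i ↦ ?_⟩
  rcases hσ x hx i with h | ⟨⟨y, hy, rfl⟩, -⟩
  · have h1 : p x i < n / N := by
      simp only [p]
      rw [div_lt_div_iff_of_pos_right hN0, hn]
      exact_mod_cast h
    have := (hmaps (hp x (hσN x hx))).1 i
    linarith
  · have h1 := hc y (hσN y hy)
    have h2 := huc _ (hp x (hσN x hx)) _ (hp y (hσN y hy)) (by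
      rw [dist_pi_lt_iff hδ]
      intro i
      rw [Real.dist_eq, abs_lt]
      constructor <;> linarith [hdist y hy i, hdist' y hy i])
    rw [dist_pi_lt_iff (half_pos hε)] at h2
    have h3 := h2 (c y)
    rw [Real.dist_eq, abs_lt] at h3
    linarith [hdist y hy (c y)]

/-- **Brouwer's fixed point theorem** for the standard simplex. -/
theorem exists_fixedPoint_of_mapsTo_stdSimplex {T : Type*} [Fintype T] [Nonempty T]
    {f : (T → ℝ) → T → ℝ} (hf : ContinuousOn f (stdSimplex ℝ T))
    (hmaps : MapsTo f (stdSimplex ℝ T) (stdSimplex ℝ T)) :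
    ∃ z ∈ stdSimplex ℝ T, f z = z := by
  classical
  have hne : (stdSimplex ℝ T).Nonempty := ⟨_, single_mem_stdSimplex ℝ (Classical.arbitrary T)⟩
  have hg : ContinuousOn (fun z ↦ ∑ i, max 0 (z i - f z i)) (stdSimplex ℝ T) := by
    refine continuousOn_finsetSum _ fun i _ ↦ ContinuousOn.sup continuousOn_const ?_
    exact (continuous_apply i).continuousOn.sub ((continuous_apply i).comp_continuousOn hf)
  obtain ⟨z, hz, hmin⟩ := (isCompact_stdSimplex ℝ T).exists_isMinOn hne hg
  rw [isMinOn_iff] at hmin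
  set m := ∑ i, max 0 (z i - f z i) with hm
  have hn0 : (0 : ℝ) < Fintype.card T := by exact_mod_cast Fintype.card_pos
  have hm0 : m ≤ 0 := by
    by_contra! hpos
    obtain ⟨y, hy, hyε⟩ := exists_forall_sub_le_of_mapsTo_stdSimplex hf hmaps
      (ε := m / (2 * Fintype.card T)) (by positivity)
    have h1 : ∑ i, max 0 (y i - f y i) ≤ ∑ _i : T, m / (2 * Fintype.card T) :=
      Finset.sum_le_sum fun i _ ↦ max_le (by positivity) (hyε i)
    rw [Finset.sum_const, Finset.card_univ, nsmul_eq_mul] at h1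
    have h2 := (hmin y hy).trans h1
    have h3 : (Fintype.card T : ℝ) * (m / (2 * Fintype.card T)) = m / 2 := by field_simp
    linarith
  have hle : ∀ i, z i ≤ f z i := fun i ↦ by
    have h1 : max 0 (z i - f z i) ≤ m :=
      Finset.single_le_sum (f := fun i ↦ max 0 (z i - f z i)) (fun i _ ↦ le_max_left _ _)
        (Finset.mem_univ i)
    linarith [le_max_right 0 (z i - f z i)]
  refine ⟨z, hz, funext fun i ↦ ?_⟩
  have hsum : ∑ i, z i = ∑ i, f z i := by rw [hz.2, (hmaps hz).2]
  exact ((Finset.sum_eq_sum_iff_of_le fun i _ ↦ hle i).1 hsum i (Finset.mem_univ i)).symm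

lemma exists_dist_lt_of_mapsTo_compact {E : Type*} [NormedAddCommGroup E] [NormedSpace ℝ E]
    {C L : Set E} (hC : Convex ℝ C) (hne : C.Nonempty) {F : E → E} (hF : ContinuousOn F C)
    (hmaps : MapsTo F C C) (hL : IsCompact L) (hFL : MapsTo F C L) {ε : ℝ} (hε : 0 < ε) :
    ∃ x ∈ C, dist (F x) x ≤ ε := by
  classical
  obtain ⟨t, htF, htfin, htcov⟩ := Metric.finite_approx_of_totallyBounded
    (hL.totallyBounded.subset hFL.image_subset) ε hε
  have := htfin.fintype
  have htC : ∀ v : t, (v : E) ∈ C := fun v ↦ hmaps.image_subset (htF v.2)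
  let φ : t → E → ℝ := fun v x ↦ max 0 (ε - dist x v)
  have hφ : ∀ v, Continuous (φ v) := fun v ↦ by fun_prop
  have hφ0 : ∀ v x, 0 ≤ φ v x := fun v x ↦ le_max_left _ _
  have hpos : ∀ x ∈ C, 0 < ∑ v, φ v (F x) := fun x hx ↦ by
    obtain ⟨v, hv, hxv⟩ := mem_iUnion₂.1 (htcov (mem_image_of_mem F hx))
    rw [Metric.mem_ball] at hxv
    exact Finset.sum_pos' (fun v _ ↦ hφ0 v _)
      ⟨⟨v, hv⟩, Finset.mem_univ _, lt_max_of_lt_right (sub_pos.2 hxv)⟩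
  have : Nonempty t := by
    obtain ⟨x, hx⟩ := hne
    obtain ⟨v, hv, -⟩ := mem_iUnion₂.1 (htcov (mem_image_of_mem F hx))
    exact ⟨⟨v, hv⟩⟩
  let g : (t → ℝ) → E := fun w ↦ ∑ v, w v • (v : E)
  have hg : Continuous g := by fun_prop
  have hgC : MapsTo g (stdSimplex ℝ t) C := fun w hw ↦
    hC.sum_mem (fun v _ ↦ hw.1 v) hw.2 fun v _ ↦ htC v
  let f : (t → ℝ) → t → ℝ := fun w v ↦ φ v (F (g w)) / ∑ v', φ v' (F (g w))
  have hFg : ContinuousOn (fun w ↦ F (g w)) (stdSimplex ℝ t) := hF.comp hg.continuousOn hgC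
  have hf : ContinuousOn f (stdSimplex ℝ t) := by
    refine continuousOn_pi.2 fun v ↦ ContinuousOn.div ((hφ v).comp_continuousOn hFg) ?_
      fun w hw ↦ (hpos _ (hgC hw)).ne'
    exact continuousOn_finsetSum _ fun v' _ ↦ (hφ v').comp_continuousOn hFg
  have hfm : MapsTo f (stdSimplex ℝ t) (stdSimplex ℝ t) := fun w hw ↦ by
    refine ⟨fun v ↦ div_nonneg (hφ0 v _) (hpos _ (hgC hw)).le, ?_⟩
    simp only [f]
    rw [← Finset.sum_div, div_self (hpos _ (hgC hw)).ne']
  obtain ⟨w, hw, hfw⟩ := exists_fixedPoint_of_mapsTo_stdSimplex hf hfm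
  refine ⟨g w, hgC hw, ?_⟩
  have h1 : F (g w) - g w = ∑ v, w v • (F (g w) - v) := by
    simp only [smul_sub, Finset.sum_sub_distrib, ← Finset.sum_smul, hw.2, one_smul, g]
  rw [dist_eq_norm, h1]
  calc ‖∑ v, w v • (F (g w) - v)‖ ≤ ∑ v, w v * ε := by
        refine norm_sum_le_of_le _ fun v _ ↦ ?_
        rw [norm_smul, Real.norm_of_nonneg (hw.1 v)]
        by_cases hv : ‖F (g w) - v‖ ≤ ε
        · exact mul_le_mul_of_nonneg_left hv (hw.1 v)
        · have h2 : w v = 0 := by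
            rw [← congrFun hfw v]
            simp only [f, φ]
            rw [max_eq_left (by rw [dist_eq_norm]; linarith), zero_div]
          simp [h2]
    _ = ε := by rw [← Finset.sum_mul, hw.2, one_mul]

/-- **Schauder's fixed point theorem**: a continuous self-map of a nonempty closed convex set whose
range lies in a compact set has a fixed point. -/
theorem exists_fixedPoint_of_mapsTo_compact {E : Type*} [NormedAddCommGroup E] [NormedSpace ℝ E]
    {C L : Set E} (hC : Convex ℝ C) (hCc : IsClosed C) (hne : C.Nonempty) {F : E → E}
    (hF : ContinuousOn F C) (hmaps : MapsTo F C C) (hL : IsCompact L) (hFL : MapsTo F C L) :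
    ∃ x ∈ C, F x = x := by
  have h : ∀ n : ℕ, ∃ x ∈ C, dist (F x) x ≤ 1 / ((n : ℝ) + 1) := fun n ↦
    exists_dist_lt_of_mapsTo_compact hC hne hF hmaps hL hFL (by positivity)
  choose x hxC hx using h
  obtain ⟨a, -, ψ, hψ, ha⟩ := hL.tendsto_subseq fun n ↦ hFL (hxC n)
  have hdist : Filter.Tendsto (fun n ↦ dist (F (x (ψ n))) (x (ψ n))) Filter.atTop (nhds 0) :=
    (squeeze_zero (fun _ ↦ dist_nonneg) hx tendsto_one_div_add_atTop_nhds_zero_nat).comp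
      hψ.tendsto_atTop
  have hxa : Filter.Tendsto (fun n ↦ x (ψ n)) Filter.atTop (nhds a) :=
    (tendsto_iff_of_dist hdist).1 ha
  have haC : a ∈ C := hCc.mem_of_tendsto hxa (Filter.Eventually.of_forall fun n ↦ hxC _)
  refine ⟨a, haC, tendsto_nhds_unique ?_ ha⟩
  exact (hF a haC).tendsto.comp (tendsto_nhdsWithin_iff.2
    ⟨hxa, Filter.Eventually.of_forall fun n ↦ hxC _⟩)

lemma IsCone.add_mem {X : Type*} [NormedAddCommGroup X] [NormedSpace ℝ X] {K : Set X}
    (hK : IsCone K) {x y : X} (hx : x ∈ K) (hy : y ∈ K) : x + y ∈ K := by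
  have h := hK.2.2.1 (hK.2.2.2.1 x hx 2 zero_le_two) (hK.2.2.2.1 y hy 2 zero_le_two)
    (show (0 : ℝ) ≤ 1 / 2 by norm_num) (show (0 : ℝ) ≤ 1 / 2 by norm_num) (by norm_num)
  simpa [smul_smul] using h

lemma IsCone.add_smul_ne_zero {X : Type*} [NormedAddCommGroup X] [NormedSpace ℝ X] {K : Set X}
    (hK : IsCone K) {x h : X} (hx : x ∈ K) (hh : h ∈ K) (h0 : h ≠ 0) {s : ℝ} (hs : 0 ≤ s)
    (hxs : s = 0 → x ≠ 0) : x + s • h ≠ 0 := by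
  intro heq
  have hsh : s • h ∈ K ∩ -K :=
    ⟨hK.2.2.2.1 h hh s hs, by rwa [Set.mem_neg, ← eq_neg_of_add_eq_zero_left heq]⟩
  rw [hK.2.2.2.2, mem_singleton_iff, smul_eq_zero] at hsh
  have hs0 := hsh.resolve_right h0
  rw [hs0, zero_smul, add_zero] at heq
  exact hxs hs0 heq

/-- The ball of a cone can be mapped into a conical shell along the direction `h`, with prescribed
norm `ν`. -/
lemma IsCone.exists_shell_map_of_norm {X : Type*} [NormedAddCommGroup X] [NormedSpace ℝ X]
    {K : Set X} (hK : IsCone K) {r R A B : ℝ} (hr : 0 < r) (hR : r < R) {h : X} (hh : h ∈ K)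
    (h0 : h ≠ 0) {ν : X → ℝ} (hν : Continuous ν)
    (hνR : ∀ x, ‖x‖ ≤ R → r ≤ ν x ∧ ν x ≤ R) (hνA : ∀ x, ‖x‖ < r → ν x = A)
    (hνB : ∀ x, ‖x‖ = R → ν x = B) :
    ∃ (P : X → X) (c s : X → ℝ) (M : ℝ),
      ContinuousOn P (K ∩ Metric.closedBall 0 R) ∧ ContinuousOn c (K ∩ Metric.closedBall 0 R) ∧
      ∀ x ∈ K ∩ Metric.closedBall 0 R, (P x ∈ K ∧ r ≤ ‖P x‖ ∧ ‖P x‖ ≤ R) ∧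
        (0 < c x ∧ c x ≤ M) ∧ 0 ≤ s x ∧ c x • P x = x + s x • h ∧
        (0 < s x → ‖P x‖ = A) ∧ (‖x‖ = R → ‖P x‖ = B ∧ s x = 0) := by
  let s : X → ℝ := fun x ↦ max 0 (r - ‖x‖)
  have hs : Continuous s := by fun_prop
  have hs0 : ∀ x, 0 ≤ s x := fun x ↦ le_max_left _ _
  let w : X → X := fun x ↦ x + s x • h
  have hw : Continuous w := by fun_prop
  have hwK : ∀ x ∈ K, w x ∈ K := fun x hx ↦ hK.add_mem hx (hK.2.2.2.1 h hh _ (hs0 x))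
  have hw0 : ∀ x ∈ K, 0 < ‖w x‖ := fun x hx ↦ norm_pos_iff.2 <|
    hK.add_smul_ne_zero hx hh h0 (hs0 x) fun hsx hx0 ↦ by
      simp only [s, hx0, norm_zero, sub_zero] at hsx
      linarith [le_max_right 0 r]
  have hnorm : ∀ x ∈ K, ‖x‖ ≤ R → ‖(ν x / ‖w x‖) • w x‖ = ν x := fun x hx hxR ↦ by
    have := (hνR x hxR).1
    rw [norm_smul, Real.norm_of_nonneg (div_nonneg (by linarith) (norm_nonneg _)),
      div_mul_cancel₀ _ (hw0 x hx).ne']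
  refine ⟨fun x ↦ (ν x / ‖w x‖) • w x, fun x ↦ ‖w x‖ / ν x, s, (R + r * ‖h‖) / r, ?_, ?_, ?_⟩
  · exact (hν.continuousOn.div hw.norm.continuousOn fun x hx ↦ (hw0 x hx.1).ne').smul
      hw.continuousOn
  · refine hw.norm.continuousOn.div hν.continuousOn fun x hx ↦ ?_
    have := (hνR x (mem_closedBall_zero_iff.1 hx.2)).1
    linarith
  · rintro x ⟨hx, hxR⟩
    rw [mem_closedBall_zero_iff] at hxR
    obtain ⟨h1, h2⟩ := hνR x hxR
    have hν0 : 0 < ν x := by linarith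
    have hw0x := hw0 x hx
    simp only [hnorm x hx hxR]
    refine ⟨⟨hK.2.2.2.1 _ (hwK x hx) _ (by positivity), h1, h2⟩, ⟨by positivity, ?_⟩, hs0 x, ?_,
      fun hsx ↦ hνA x ?_, fun hx ↦ ⟨hνB x hx, max_eq_left (by linarith)⟩⟩
    · have h3 : ‖w x‖ ≤ R + r * ‖h‖ := by
        refine (norm_add_le _ _).trans (add_le_add hxR ?_)
        rw [norm_smul, Real.norm_of_nonneg (hs0 x)]
        exact mul_le_mul_of_nonneg_right (max_le hr.le (by linarith [norm_nonneg x]))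
          (norm_nonneg _)
      exact div_le_div₀ ((norm_nonneg _).trans h3) h3 hr h1
    · rw [smul_smul, div_mul_div_cancel₀ hν0.ne', div_self hw0x.ne', one_smul]
    · by_contra! hle
      exact hsx.ne' (max_eq_left (by linarith))

lemma IsCone.exists_shell_map {X : Type*} [NormedAddCommGroup X] [NormedSpace ℝ X]
    {K : Set X} (hK : IsCone K) {r R A B : ℝ} (hr : 0 < r) (hR : r < R)
    (hAB : A = r ∧ B = R ∨ A = R ∧ B = r) {h : X} (hh : h ∈ K) (h0 : h ≠ 0) :
    ∃ (P : X → X) (c s : X → ℝ) (M : ℝ),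
      ContinuousOn P (K ∩ Metric.closedBall 0 R) ∧ ContinuousOn c (K ∩ Metric.closedBall 0 R) ∧
      ∀ x ∈ K ∩ Metric.closedBall 0 R, (P x ∈ K ∧ r ≤ ‖P x‖ ∧ ‖P x‖ ≤ R) ∧
        (0 < c x ∧ c x ≤ M) ∧ 0 ≤ s x ∧ c x • P x = x + s x • h ∧
        (0 < s x → ‖P x‖ = A) ∧ (‖x‖ = R → ‖P x‖ = B ∧ s x = 0) := by
  have hR0 : 0 < R := hr.trans hR
  have hmax : ∀ x : X, 0 < max r ‖x‖ := fun x ↦ lt_max_of_lt_left hr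
  rcases hAB with ⟨rfl, rfl⟩ | ⟨rfl, rfl⟩
  · exact hK.exists_shell_map_of_norm hr hR hh h0 (ν := fun x ↦ max A ‖x‖) (by fun_prop)
      (fun x hx ↦ ⟨le_max_left _ _, max_le hR.le hx⟩) (fun x hx ↦ max_eq_left hx.le)
      (fun x hx ↦ by simp only [hx]; exact max_eq_right hR.le)
  · refine hK.exists_shell_map_of_norm hr hR hh h0 (ν := fun x ↦ B * A / max B ‖x‖)
      (continuous_const.div (by fun_prop) fun x ↦ (hmax x).ne')
      (fun x hx ↦ ⟨?_, ?_⟩) (fun x hx ↦ ?_) (fun x hx ↦ ?_)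
    · rw [le_div_iff₀ (hmax x)]
      exact mul_le_mul_of_nonneg_left (max_le hR.le hx) hr.le
    · rw [div_le_iff₀ (hmax x), mul_comm]
      exact mul_le_mul_of_nonneg_left (le_max_left _ _) hR0.le
    · simp only [max_eq_left hx.le]
      field_simp
    · simp only [hx, max_eq_right hR.le]
      field_simp

/-- The radial retraction onto the ball of radius `R`. -/
noncomputable def radialRetraction {X : Type*} [NormedAddCommGroup X] [NormedSpace ℝ X] (R : ℝ)
    (x : X) : X :=
  (R / max R ‖x‖) • x

section RadialRetraction

variable {X : Type*} [NormedAddCommGroup X] [NormedSpace ℝ X] {R : ℝ}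

lemma continuous_radialRetraction (hR : 0 < R) : Continuous (radialRetraction R : X → X) :=
  (continuous_const.div (by fun_prop) fun _ ↦ (lt_max_of_lt_left hR).ne').smul continuous_id

lemma norm_radialRetraction (hR : 0 < R) (x : X) :
    ‖radialRetraction R x‖ = R / max R ‖x‖ * ‖x‖ := by
  rw [radialRetraction, norm_smul, Real.norm_of_nonneg (div_nonneg hR.le (by positivity))]

lemma norm_radialRetraction_le (hR : 0 < R) (x : X) : ‖radialRetraction R x‖ ≤ R := by
  have : 0 < max R ‖x‖ := lt_max_of_lt_left hR
  rw [norm_radialRetraction hR, div_mul_eq_mul_div, div_le_iff₀ this]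
  exact mul_le_mul_of_nonneg_left (le_max_right _ _) hR.le

lemma eq_of_radialRetraction_eq (hR : 0 < R) {x P t h : X} {c s : ℝ} (hc : 0 < c) (hs : 0 ≤ s)
    (hP : c • P = x + s • h) (hin : 0 < s → ∀ μ : ℝ, 0 < μ → t + μ • h ≠ P)
    (hout : ‖x‖ = R → s = 0 ∧ ∀ l : ℝ, 1 < l → t ≠ l • P)
    (hx : radialRetraction R (c • t) = x) : t = P := by
  rcases le_or_gt ‖c • t‖ R with hle | hlt
  · rw [radialRetraction, max_eq_left hle, div_self hR.ne', one_smul] at hx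
    rcases hs.eq_or_lt with rfl | hs
    · rw [← hx, zero_smul, add_zero] at hP
      exact (smul_right_injective X hc.ne' hP).symm
    · refine absurd ?_ (hin hs (s / c) (by positivity))
      apply smul_right_injective X hc.ne'
      simp only
      rw [hP, smul_add, smul_smul, mul_div_cancel₀ _ hc.ne', hx]
  · have hn : ‖x‖ = R := by
      rw [← hx, norm_radialRetraction hR, max_eq_right hlt.le,
        div_mul_cancel₀ _ (hR.trans hlt).ne']
    obtain ⟨rfl, hl⟩ := hout hn
    refine absurd ?_ (hl (‖c • t‖ / R) ((one_lt_div hR).2 hlt))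
    apply smul_right_injective X hc.ne'
    simp only
    rw [smul_comm, hP, zero_smul, add_zero, ← hx, radialRetraction, max_eq_right hlt.le, smul_smul,
      div_mul_div_cancel₀ hR.ne', div_self (hR.trans hlt).ne', one_smul]

end RadialRetraction

theorem krasnoselskii_precup_homotopy
    {X Y : Type*} [NormedAddCommGroup X] [NormedSpace ℝ X]
    [NormedAddCommGroup Y] [NormedSpace ℝ Y]
    {K₁ : Set X} {K₂ : Set Y} (hK₁ : IsCone K₁) (hK₂ : IsCone K₂)
    {r₁ r₂ R₁ R₂ : ℝ} (hr₁ : 0 < r₁) (hR₁ : r₁ < R₁) (hr₂ : 0 < r₂) (hR₂ : r₂ < R₂)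
    (T₁ : X × Y → X) (T₂ : X × Y → Y)
    (hmap : ∀ p ∈ KrR K₁ K₂ r₁ r₂ R₁ R₂, T₁ p ∈ K₁ ∧ T₂ p ∈ K₂)
    (hcont : ContinuousOn (fun p => (T₁ p, T₂ p)) (KrR K₁ K₂ r₁ r₂ R₁ R₂))
    (hcpt : IsCompact (closure ((fun p => (T₁ p, T₂ p)) '' (KrR K₁ K₂ r₁ r₂ R₁ R₂))))
    (hyp₁ : ∃ h₁ ∈ K₁, h₁ ≠ 0 ∧
      ((∀ p ∈ KrR K₁ K₂ r₁ r₂ R₁ R₂,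
          (‖p.1‖ = r₁ → ∀ μ : ℝ, 0 < μ → T₁ p + μ • h₁ ≠ p.1) ∧
          (‖p.1‖ = R₁ → ∀ l : ℝ, 1 < l → T₁ p ≠ l • p.1)) ∨
       (∀ p ∈ KrR K₁ K₂ r₁ r₂ R₁ R₂,
          (‖p.1‖ = r₁ → ∀ l : ℝ, 1 < l → T₁ p ≠ l • p.1) ∧
          (‖p.1‖ = R₁ → ∀ μ : ℝ, 0 < μ → T₁ p + μ • h₁ ≠ p.1))))
    (hyp₂ : ∃ h₂ ∈ K₂, h₂ ≠ 0 ∧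
      ((∀ p ∈ KrR K₁ K₂ r₁ r₂ R₁ R₂,
          (‖p.2‖ = r₂ → ∀ μ : ℝ, 0 < μ → T₂ p + μ • h₂ ≠ p.2) ∧
          (‖p.2‖ = R₂ → ∀ l : ℝ, 1 < l → T₂ p ≠ l • p.2)) ∨
       (∀ p ∈ KrR K₁ K₂ r₁ r₂ R₁ R₂,
          (‖p.2‖ = r₂ → ∀ l : ℝ, 1 < l → T₂ p ≠ l • p.2) ∧
          (‖p.2‖ = R₂ → ∀ μ : ℝ, 0 < μ → T₂ p + μ • h₂ ≠ p.2)))) :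
    ∃ p ∈ KrR K₁ K₂ r₁ r₂ R₁ R₂, T₁ p = p.1 ∧ T₂ p = p.2 := by
  obtain ⟨h₁, hh₁, h₁0, H₁⟩ := hyp₁
  obtain ⟨h₂, hh₂, h₂0, H₂⟩ := hyp₂
  have hR₁0 : 0 < R₁ := hr₁.trans hR₁
  have hR₂0 : 0 < R₂ := hr₂.trans hR₂
  obtain ⟨A₁, B₁, hAB₁, H₁⟩ : ∃ A B : ℝ, (A = r₁ ∧ B = R₁ ∨ A = R₁ ∧ B = r₁) ∧
      ∀ p ∈ KrR K₁ K₂ r₁ r₂ R₁ R₂,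
        (‖p.1‖ = A → ∀ μ : ℝ, 0 < μ → T₁ p + μ • h₁ ≠ p.1) ∧
        (‖p.1‖ = B → ∀ l : ℝ, 1 < l → T₁ p ≠ l • p.1) := by
    rcases H₁ with H | H
    · exact ⟨r₁, R₁, Or.inl ⟨rfl, rfl⟩, H⟩
    · exact ⟨R₁, r₁, Or.inr ⟨rfl, rfl⟩, fun p hp ↦ (H p hp).symm⟩
  obtain ⟨A₂, B₂, hAB₂, H₂⟩ : ∃ A B : ℝ, (A = r₂ ∧ B = R₂ ∨ A = R₂ ∧ B = r₂) ∧
      ∀ p ∈ KrR K₁ K₂ r₁ r₂ R₁ R₂,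
        (‖p.2‖ = A → ∀ μ : ℝ, 0 < μ → T₂ p + μ • h₂ ≠ p.2) ∧
        (‖p.2‖ = B → ∀ l : ℝ, 1 < l → T₂ p ≠ l • p.2) := by
    rcases H₂ with H | H
    · exact ⟨r₂, R₂, Or.inl ⟨rfl, rfl⟩, H⟩
    · exact ⟨R₂, r₂, Or.inr ⟨rfl, rfl⟩, fun p hp ↦ (H p hp).symm⟩
  obtain ⟨P₁, c₁, s₁, M₁, hP₁, hc₁, hx₁⟩ := hK₁.exists_shell_map hr₁ hR₁ hAB₁ hh₁ h₁0
  obtain ⟨P₂, c₂, s₂, M₂, hP₂, hc₂, hx₂⟩ := hK₂.exists_shell_map hr₂ hR₂ hAB₂ hh₂ h₂0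
  set D₁ := K₁ ∩ Metric.closedBall (0 : X) R₁ with hD₁
  set D₂ := K₂ ∩ Metric.closedBall (0 : Y) R₂ with hD₂
  have hp : MapsTo (fun x : X × Y ↦ (P₁ x.1, P₂ x.2)) (D₁ ×ˢ D₂)
      (KrR K₁ K₂ r₁ r₂ R₁ R₂) := fun x hx ↦ by
    obtain ⟨⟨a1, a2, a3⟩, -⟩ := hx₁ _ hx.1
    obtain ⟨⟨b1, b2, b3⟩, -⟩ := hx₂ _ hx.2
    exact ⟨a1, b1, a2, a3, b2, b3⟩
  let G : ℝ × ℝ × X × Y → X × Y := fun q ↦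
    (radialRetraction R₁ (q.1 • q.2.2.1), radialRetraction R₂ (q.2.1 • q.2.2.2))
  have hG : Continuous G :=
    ((continuous_radialRetraction hR₁0).comp (by fun_prop)).prodMk
      ((continuous_radialRetraction hR₂0).comp (by fun_prop))
  let F : X × Y → X × Y := fun x ↦
    G (c₁ x.1, c₂ x.2, T₁ (P₁ x.1, P₂ x.2), T₂ (P₁ x.1, P₂ x.2))
  have hfst : MapsTo Prod.fst (D₁ ×ˢ D₂) D₁ := fun x hx ↦ hx.1
  have hsnd : MapsTo Prod.snd (D₁ ×ˢ D₂) D₂ := fun x hx ↦ hx.2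
  have hFcont : ContinuousOn F (D₁ ×ˢ D₂) := by
    refine hG.comp_continuousOn ((hc₁.comp continuousOn_fst hfst).prodMk
      ((hc₂.comp continuousOn_snd hsnd).prodMk ?_))
    exact hcont.comp ((hP₁.comp continuousOn_fst hfst).prodMk
      (hP₂.comp continuousOn_snd hsnd)) hp
  have hFmaps : MapsTo F (D₁ ×ˢ D₂) (D₁ ×ˢ D₂) := fun x hx ↦ by
    obtain ⟨h1, h2⟩ := hmap _ (hp hx)
    obtain ⟨-, ⟨a, -⟩, -⟩ := hx₁ _ hx.1
    obtain ⟨-, ⟨b, -⟩, -⟩ := hx₂ _ hx.2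
    exact ⟨⟨hK₁.2.2.2.1 _ (hK₁.2.2.2.1 _ h1 _ a.le) _ (by positivity),
        mem_closedBall_zero_iff.2 (norm_radialRetraction_le hR₁0 _)⟩,
      ⟨hK₂.2.2.2.1 _ (hK₂.2.2.2.1 _ h2 _ b.le) _ (by positivity),
        mem_closedBall_zero_iff.2 (norm_radialRetraction_le hR₂0 _)⟩⟩
  have hL := ((isCompact_Icc (a := (0 : ℝ)) (b := M₁)).prod
    ((isCompact_Icc (a := (0 : ℝ)) (b := M₂)).prod hcpt)).image hG
  have hFL : MapsTo F (D₁ ×ˢ D₂) (G '' (Icc 0 M₁ ×ˢ Icc 0 M₂ ×ˢ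
      closure ((fun p => (T₁ p, T₂ p)) '' (KrR K₁ K₂ r₁ r₂ R₁ R₂)))) := fun x hx ↦ by
    obtain ⟨-, ⟨a, a'⟩, -⟩ := hx₁ _ hx.1
    obtain ⟨-, ⟨b, b'⟩, -⟩ := hx₂ _ hx.2
    exact mem_image_of_mem G ⟨⟨a.le, a'⟩, ⟨b.le, b'⟩,
      subset_closure (mem_image_of_mem (fun p ↦ (T₁ p, T₂ p)) (hp hx))⟩
  have hne : (D₁ ×ˢ D₂).Nonempty := by
    obtain ⟨x, hx⟩ := hK₁.1
    obtain ⟨y, hy⟩ := hK₂.1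
    refine ⟨(0, 0), ⟨?_, by simp [hR₁0.le]⟩, ?_, by simp [hR₂0.le]⟩
    · simpa using hK₁.2.2.2.1 x hx 0 le_rfl
    · simpa using hK₂.2.2.2.1 y hy 0 le_rfl
  obtain ⟨x, hx, hFx⟩ := exists_fixedPoint_of_mapsTo_compact
    ((hK₁.2.2.1.inter (convex_closedBall _ _)).prod (hK₂.2.2.1.inter (convex_closedBall _ _)))
    ((hK₁.2.1.inter Metric.isClosed_closedBall).prod
      (hK₂.2.1.inter Metric.isClosed_closedBall)) hne hFcont hFmaps hL hFL
  refine ⟨(P₁ x.1, P₂ x.2), hp hx, ?_, ?_⟩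
  · obtain ⟨-, ⟨a1, -⟩, a2, a3, a4, a5⟩ := hx₁ _ hx.1
    obtain ⟨H, H'⟩ := H₁ _ (hp hx)
    exact eq_of_radialRetraction_eq hR₁0 a1 a2 a3 (fun h ↦ H (a4 h))
      (fun h ↦ ⟨(a5 h).2, H' (a5 h).1⟩) (congrArg Prod.fst hFx)
  · obtain ⟨-, ⟨a1, -⟩, a2, a3, a4, a5⟩ := hx₂ _ hx.2
    obtain ⟨H, H'⟩ := H₂ _ (hp hx)
    exact eq_of_radialRetraction_eq hR₂0 a1 a2 a3 (fun h ↦ H (a4 h))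
      (fun h ↦ ⟨(a5 h).2, H' (a5 h).1⟩) (congrArg Prod.snd hFx)
end

section
/- (Existence under homotopy-compression conditions in order-preserving cones) Let K₁, K₂ be cones in normed linear spaces X, Y whose norms preserve the respective order relations ≺ᵢ over Kᵢ, let K = K₁ × K₂ and r = (r₁,r₂), R = (R₁,R₂) with 0 < rᵢ < Rᵢ (i = 1,2). Assume T = (T₁,T₂) : K̄_{r,R} → K is a compact map and for each i ∈ {1,2} there exists hᵢ ∈ Kᵢ \ {0} such that for all x = (x₁,x₂) ∈ K̄_{r,R}: Tᵢx + μhᵢ ≠ xᵢ whenever ‖xᵢ‖ = rᵢ and μ > 0, and Tᵢx ≠ λxᵢ whenever ‖xᵢ‖ = Rᵢ and λ > 1. Then T has at least one fixed point x̄ = (x̄₁,x̄₂) with rᵢ ≤ ‖x̄ᵢ‖ ≤ Rᵢ for i = 1,2. -/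
open Set

open MeasureTheory Metric Filter Topology

theorem LipschitzOnWith.indicator_closedBall {E F : Type*} [NormedAddCommGroup E] [NormedSpace ℝ E]
    [Nontrivial E] [NormedAddCommGroup F] {g : E → F} {C : NNReal}
    (hg : LipschitzOnWith C g (closedBall 0 1)) (h0 : ∀ x, ‖x‖ = 1 → g x = 0) :
    LipschitzWith C ((closedBall (0 : E) 1).indicator g) := by
  have key : ∀ x y : E, ‖x‖ ≤ 1 → 1 < ‖y‖ → ‖g x‖ ≤ C * ‖x - y‖ := by
    intro x y hx hy
    obtain ⟨z, hz, hxz⟩ : ∃ z : E, ‖z‖ = 1 ∧ x = ‖x‖ • z := by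
      rcases eq_or_ne x 0 with rfl | hx0
      · obtain ⟨z, hz⟩ := exists_norm_eq E zero_le_one
        exact ⟨z, hz, by simp⟩
      · have := norm_ne_zero_iff.2 hx0
        exact ⟨‖x‖⁻¹ • x, by simp [norm_smul, this],
          by rw [smul_smul, mul_inv_cancel₀ this, one_smul]⟩
    have h1 := hg.dist_le_mul x (by simpa using hx) z (by simp [hz])
    rw [h0 z hz, dist_zero_right, dist_eq_norm] at h1
    refine h1.trans (mul_le_mul_of_nonneg_left ?_ C.2)
    have h2 : ‖x - z‖ = 1 - ‖x‖ := by
      have : x - z = (‖x‖ - 1) • z := by rw [sub_smul, one_smul, ← hxz]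
      rw [this, norm_smul, hz, mul_one, Real.norm_eq_abs, abs_of_nonpos (by linarith)]
      ring
    have h3 := norm_sub_norm_le y x
    rw [norm_sub_rev] at h3
    linarith
  refine LipschitzWith.of_dist_le_mul fun x y ↦ ?_
  by_cases hx : ‖x‖ ≤ 1 <;> by_cases hy : ‖y‖ ≤ 1
  · simpa [indicator, hx, hy] using hg.dist_le_mul x (by simpa using hx) y (by simpa using hy)
  · simpa [indicator, hx, hy, dist_eq_norm] using key x y hx (not_le.1 hy)
  · simpa [indicator, hx, hy, dist_eq_norm, norm_sub_rev] using key y x hy (not_le.1 hx)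
  · simpa [indicator, hx, hy] using by positivity

theorem bijOn_closedBall_add_smul {E : Type*} [NormedAddCommGroup E] [NormedSpace ℝ E]
    [CompleteSpace E] [Nontrivial E] {g : E → E} {C : NNReal}
    (hg : LipschitzOnWith C g (closedBall 0 1)) (h0 : ∀ x, ‖x‖ = 1 → g x = 0)
    {t : ℝ} (ht : 0 ≤ t) (htC : t * C < 1) :
    BijOn (fun x ↦ x + t • g x) (closedBall 0 1) (closedBall 0 1) := by
  set G := (closedBall (0 : E) 1).indicator g with hG
  have hL := hg.indicator_closedBall h0
  have hGx : ∀ x ∈ closedBall (0 : E) 1, G x = g x := fun x hx ↦ indicator_of_mem hx g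
  have hGx' : ∀ x ∉ closedBall (0 : E) 1, G x = 0 := fun x hx ↦ indicator_of_notMem hx g
  have hctr : ∀ y, ContractingWith (t.toNNReal * C) (fun x ↦ y - t • G x) := by
    intro y
    refine ⟨?_, LipschitzWith.of_dist_le_mul fun a b ↦ ?_⟩
    · rw [← NNReal.coe_lt_coe]
      simpa [ht] using htC
    · simp only [dist_sub_left, dist_smul₀, NNReal.coe_mul, Real.coe_toNNReal _ ht,
        Real.norm_eq_abs, abs_of_nonneg ht, mul_assoc]
      exact mul_le_mul_of_nonneg_left (hL.dist_le_mul a b) ht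
  have hinj : ∀ a b, a + t • G a = b + t • G b → a = b := by
    intro a b hab
    refine (hctr (a + t • G a)).fixedPoint_unique' (x := a) (y := b) ?_ ?_
    · simp [Function.IsFixedPt]
    · simp [Function.IsFixedPt, hab]
  have hmaps : ∀ x ∈ closedBall (0 : E) 1, x + t • G x ∈ closedBall (0 : E) 1 := by
    intro x hx
    by_contra hcon
    have := hinj (x + t • G x) x (by simp [hGx' _ hcon])
    rw [this] at hcon
    exact hcon hx
  refine ⟨fun x hx ↦ ?_, fun a ha b hb hab ↦ ?_, fun y hy ↦ ?_⟩
  · simpa only [hGx x hx] using hmaps x hx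
  · exact hinj a b (by simpa only [hGx a ha, hGx b hb] using hab)
  · have hfix := (hctr y).fixedPoint_isFixedPt
    set z := ContractingWith.fixedPoint _ (hctr y)
    have hz : z + t • G z = y := by
      rw [Function.IsFixedPt] at hfix
      nth_rewrite 1 [← hfix]
      simp
    have hzb : z ∈ closedBall (0 : E) 1 := by
      by_contra hcon
      rw [hGx' z hcon, smul_zero, add_zero] at hz
      exact hcon (hz ▸ hy)
    exact ⟨z, hzb, by simpa only [hGx z hzb] using hz⟩

/-- The determinant of `1 + A` is a combination, with weights independent of `A`, of the
determinants of `1 + t • A` for `t` in any finite set with more elements than the dimension. -/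
theorem det_one_add_eq_sum {E : Type*} [NormedAddCommGroup E] [NormedSpace ℝ E]
    [FiniteDimensional ℝ E] {s : Finset ℝ} (hs : Module.finrank ℝ E < s.card) (A : E →L[ℝ] E) :
    (1 + A).det = ∑ t ∈ s, (1 + t • A).det * (Lagrange.basis s id t).eval 1 := by
  classical
  set b := Module.finBasis ℝ E
  set M := LinearMap.toMatrix b b (A : E →ₗ[ℝ] E)
  set p := Matrix.det ((Polynomial.X : Polynomial ℝ) • M.map Polynomial.C +
    (1 : Matrix _ _ ℝ).map Polynomial.C)
  have hp : ∀ t : ℝ, p.eval t = (1 + t • A).det := by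
    intro t
    have : (1 + t • A).det = (1 + t • M).det := by
      rw [ContinuousLinearMap.det, ← LinearMap.det_toMatrix b]
      congr 1
      rw [ContinuousLinearMap.toLinearMap_add, ContinuousLinearMap.toLinearMap_smul, map_add,
        map_smul]
      congr 1
      exact LinearMap.toMatrix_one b
    rw [this, ← Polynomial.coe_evalRingHom, RingHom.map_det]
    congr 1
    ext i j
    simp [Matrix.one_apply, apply_ite, add_comm, Matrix.map_apply]
    ring
  have hdeg : p.degree < s.card := by
    refine Polynomial.degree_le_natDegree.trans_lt ?_
    have := Polynomial.natDegree_det_X_add_C_le M 1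
    rw [Fintype.card_fin] at this
    exact_mod_cast this.trans_lt hs
  have := congrArg (Polynomial.eval 1)
    (Lagrange.eq_interpolate (v := id) Function.injective_id.injOn hdeg)
  rw [hp, one_smul] at this
  rw [this, Lagrange.interpolate_apply, Polynomial.eval_finsetSum]
  simp [hp]


theorem det_one_add_smul_pos {E : Type*} [NormedAddCommGroup E] [NormedSpace ℝ E]
    [FiniteDimensional ℝ E] {A : E →L[ℝ] E} {t : ℝ} (ht : 0 ≤ t) (htA : t * ‖A‖ < 1) :
    0 < (1 + t • A).det := by
  have hne : ∀ s ∈ Icc 0 t, (1 + s • A).det ≠ 0 := by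
    intro s hs h0
    obtain ⟨v, hv, hv0⟩ := (LinearMap.hasEigenvalue_zero_tfae
      ((1 + s • A : E →L[ℝ] E) : E →ₗ[ℝ] E)).out 3 5 |>.1 h0
    have h1 : v = -(s • A v) := eq_neg_of_add_eq_zero_left (by simpa using hv0)
    have h2 : ‖v‖ ≤ s * ‖A‖ * ‖v‖ := by
      nth_rewrite 1 [h1]
      rw [norm_neg, norm_smul, Real.norm_of_nonneg hs.1, mul_assoc]
      exact mul_le_mul_of_nonneg_left (A.le_opNorm v) hs.1
    have h3 : s * ‖A‖ ≤ t * ‖A‖ := mul_le_mul_of_nonneg_right hs.2 (norm_nonneg _)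
    have := norm_pos_iff.2 hv
    nlinarith
  have hcont : ContinuousOn (fun s : ℝ ↦ (1 + s • A).det) (Icc 0 t) :=
    (ContinuousLinearMap.continuous_det.comp (by fun_prop)).continuousOn
  by_contra! hle
  obtain ⟨s, hs, hs0⟩ := intermediate_value_Icc' ht hcont ⟨hle, by simp [ContinuousLinearMap.det]⟩
  exact hne s hs hs0

/-- A `C¹` map cannot retract the closed unit ball onto the unit sphere. -/
theorem not_forall_norm_add_eq_one {E : Type*} [NormedAddCommGroup E] [InnerProductSpace ℝ E]
    [FiniteDimensional ℝ E] [Nontrivial E] {g : E → E}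
    (hg : ∀ x ∈ closedBall (0 : E) 1, ContDiffAt ℝ 1 g x) (h0 : ∀ x, ‖x‖ = 1 → g x = 0) :
    ¬ ∀ x ∈ closedBall (0 : E) 1, ‖x + g x‖ = 1 := by
  intro hone
  borelize E
  have hcpt : IsCompact (closedBall (0 : E) 1) := isCompact_closedBall 0 1
  have hdiff : ∀ x ∈ closedBall (0 : E) 1, DifferentiableAt ℝ g x :=
    fun x hx ↦ (hg x hx).differentiableAt one_ne_zero
  have hcont : ContinuousOn (fderiv ℝ g) (closedBall 0 1) := fun x hx ↦
    ((hg x hx).fderiv_right (m := 0) (by simp)).continuousAt.continuousWithinAt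
  obtain ⟨C, hC⟩ := hcpt.exists_bound_of_continuousOn hcont
  have hC0 : 0 ≤ C := (norm_nonneg _).trans (hC 0 (by simp))
  lift C to NNReal using hC0
  have hlip : LipschitzOnWith C g (closedBall 0 1) :=
    Convex.lipschitzOnWith_of_nnnorm_fderiv_le hdiff (fun x hx ↦ hC x hx) (convex_closedBall 0 1)
  set μ : Measure E := Measure.addHaar
  have hvol : ∀ t : ℝ, 0 ≤ t → t * C < 1 →
      ∫ x in closedBall (0 : E) 1, (1 + t • fderiv ℝ g x).det ∂μ = μ.real (closedBall 0 1) := by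
    intro t ht htC
    have hbij := bijOn_closedBall_add_smul hlip h0 ht htC
    have hint := integral_image_eq_integral_abs_det_fderiv_smul μ
      (measurableSet_closedBall (x := (0 : E)) (ε := 1)) (f := fun x ↦ x + t • g x)
      (f' := fun x ↦ 1 + t • fderiv ℝ g x)
      (fun x hx ↦
        ((hasFDerivAt_id x).add ((hdiff x hx).hasFDerivAt.const_smul t)).hasFDerivWithinAt)
      hbij.injOn (fun _ ↦ (1 : ℝ))
    rw [hbij.image_eq] at hint
    simp only [integral_const, smul_eq_mul, mul_one, measureReal_restrict_apply_univ] at hint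
    rw [hint]
    refine setIntegral_congr_fun measurableSet_closedBall fun x hx ↦ ?_
    rw [abs_of_pos (det_one_add_smul_pos ht ?_)]
    exact (mul_le_mul_of_nonneg_left (hC x hx) ht).trans_lt htC
  obtain ⟨s, hs, hcard⟩ :=
    (Ioo_infinite (show (0 : ℝ) < (C + 1 : ℝ)⁻¹ by positivity)).exists_subset_card_eq
      (Module.finrank ℝ E + 1)
  have hsum : ∫ x in closedBall (0 : E) 1, (1 + fderiv ℝ g x).det ∂μ = μ.real (closedBall 0 1) := by
    rw [setIntegral_congr_fun measurableSet_closedBall fun x _ ↦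
      det_one_add_eq_sum (s := s) (by omega) (fderiv ℝ g x), integral_finsetSum]
    · have hs' : ∀ t ∈ s, ∫ x in closedBall (0 : E) 1, (1 + t • fderiv ℝ g x).det *
          (Lagrange.basis s id t).eval 1 ∂μ =
          μ.real (closedBall 0 1) * (Lagrange.basis s id t).eval 1 := by
        intro t ht
        rw [integral_mul_const, hvol t (hs ht).1.le]
        have h1 : t * (C + 1) < 1 := by
          rw [← lt_div_iff₀ (by positivity), one_div]
          exact (hs ht).2
        linarith [(hs ht).1]
      rw [Finset.sum_congr rfl hs', ← Finset.mul_sum, ← Polynomial.eval_finsetSum,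
        Lagrange.sum_basis Function.injective_id.injOn (Finset.card_pos.1 (by omega))]
      simp
    · intro t _
      refine Integrable.mul_const ?_ _
      refine ContinuousOn.integrableOn_compact hcpt ?_
      exact ContinuousLinearMap.continuous_det.comp_continuousOn
        (continuousOn_const.add (hcont.const_smul t))
  have hzero : ∀ x ∈ closedBall (0 : E) 1, (1 + fderiv ℝ g x).det = 0 := by
    intro x hx
    by_contra hdet
    have h1 : HasFDerivWithinAt (fun y ↦ y + g y) (1 + fderiv ℝ g x) (closedBall 0 1) x :=
      ((hasFDerivAt_id x).add (hdiff x hx).hasFDerivAt).hasFDerivWithinAt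
    have h2 := h1.norm_sq
    have h3 : HasFDerivWithinAt (fun y ↦ ‖y + g y‖ ^ 2) (0 : E →L[ℝ] ℝ) (closedBall 0 1) x :=
      (hasFDerivWithinAt_const (1 : ℝ) x _).congr (fun y hy ↦ by simp [hone y hy])
        (by simp [hone x hx])
    have h4 := (uniqueDiffOn_convex (convex_closedBall (0 : E) 1)
      (by simp [interior_closedBall])).eq hx h2 h3
    obtain ⟨v, hv⟩ : ∃ v, (1 + fderiv ℝ g x) v = x + g x :=
      (LinearMap.equivOfDetNeZero _ hdet).surjective (x + g x)
    have h5 : 2 • inner ℝ (x + g x) ((1 + fderiv ℝ g x) v) = (0 : ℝ) := DFunLike.congr_fun h4 v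
    rw [hv, real_inner_self_eq_norm_sq, hone x hx] at h5
    norm_num at h5
  rw [setIntegral_congr_fun measurableSet_closedBall hzero, integral_zero] at hsum
  have : 0 < μ.real (closedBall (0 : E) 1) :=
    ENNReal.toReal_pos (measure_closedBall_pos μ 0 one_pos).ne' hcpt.measure_lt_top.ne
  linarith

theorem exists_fixed_point_of_contDiff {E : Type*} [NormedAddCommGroup E] [InnerProductSpace ℝ E]
    [FiniteDimensional ℝ E] [Nontrivial E] {f : E → E} (hf : ContDiff ℝ 1 f)
    (hball : ∀ x, ‖f x‖ ≤ 1) : ∃ x ∈ closedBall (0 : E) 1, f x = x := by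
  by_contra! hne
  set u : E → E := fun x ↦ x - f x
  set a : E → ℝ := fun x ↦ inner ℝ x (u x)
  set D : E → ℝ := fun x ↦ a x ^ 2 + ‖u x‖ ^ 2 * (1 - ‖x‖ ^ 2)
  have hu : ∀ x ∈ closedBall (0 : E) 1, 0 < ‖u x‖ ^ 2 := fun x hx ↦
    pow_pos (norm_pos_iff.2 (sub_ne_zero.2 (hne x hx).symm)) 2
  have ha : ∀ x ∈ closedBall (0 : E) 1, ‖x‖ = 1 → 0 < a x := by
    intro x hx hx1
    have h1 : ‖u x‖ ^ 2 = ‖x‖ ^ 2 - 2 * inner ℝ x (f x) + ‖f x‖ ^ 2 := norm_sub_sq_real x (f x)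
    have h2 : a x = ‖x‖ ^ 2 - inner ℝ x (f x) := by
      simp only [a, u, inner_sub_right, real_inner_self_eq_norm_sq]
    have h3 := hu x hx
    have h4 : ‖f x‖ ^ 2 ≤ 1 := pow_le_one₀ (norm_nonneg _) (hball x)
    rw [hx1] at h1 h2
    linarith
  have hD : ∀ x ∈ closedBall (0 : E) 1, 0 < D x := by
    intro x hx
    have h1 : ‖x‖ ≤ 1 := by simpa using hx
    rcases h1.lt_or_eq with h | h
    · have : 0 < 1 - ‖x‖ ^ 2 := by nlinarith [norm_nonneg x]
      have := mul_pos (hu x hx) this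
      positivity
    · have := ha x hx h
      simp only [D, h]
      positivity
  refine not_forall_norm_add_eq_one (g := fun x ↦ ((-a x + √(D x)) / ‖u x‖ ^ 2) • u x)
    (fun x hx ↦ ?_) (fun x hx1 ↦ ?_) (fun x hx ↦ ?_)
  · have hu' : ContDiff ℝ 1 u := contDiff_id.sub hf
    have ha' : ContDiff ℝ 1 a := contDiff_id.inner ℝ hu'
    have hD' : ContDiff ℝ 1 D :=
      (ha'.pow 2).add ((hu'.norm_sq ℝ).mul (contDiff_const.sub (contDiff_id.norm_sq ℝ)))
    exact ((ha'.contDiffAt.neg.add (hD'.contDiffAt.sqrt (hD x hx).ne')).div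
      (hu'.norm_sq ℝ).contDiffAt (hu x hx).ne').smul hu'.contDiffAt
  · have hx : x ∈ closedBall (0 : E) 1 := by simp [hx1]
    simp [D, hx1, Real.sqrt_sq (ha x hx hx1).le]
  · have h1 := hu x hx
    have h2 := Real.sq_sqrt (hD x hx).le
    set s := (-a x + √(D x)) / ‖u x‖ ^ 2 with hs
    have h3 : s * ‖u x‖ ^ 2 = -a x + √(D x) := div_mul_cancel₀ _ h1.ne'
    have h4 : ‖x + s • u x‖ ^ 2 = ‖x‖ ^ 2 + 2 * (s * a x) + s ^ 2 * ‖u x‖ ^ 2 := by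
      rw [norm_add_sq_real, inner_smul_right, norm_smul, mul_pow, Real.norm_eq_abs, sq_abs]
    have h5 : √(D x) = s * ‖u x‖ ^ 2 + a x := by linarith
    rw [h5] at h2
    have h6 : ‖u x‖ ^ 2 * (‖x + s • u x‖ ^ 2 - 1) = 0 := by
      rw [h4]
      simp only [D] at h2
      linear_combination h2
    have h7 : ‖x + s • u x‖ ^ 2 = 1 := by
      linarith [(mul_eq_zero.1 h6).resolve_left h1.ne']
    exact (pow_eq_one_iff_of_nonneg (norm_nonneg _) two_ne_zero).1 h7

/-- Brouwer's fixed point theorem for maps of a Euclidean space into its closed unit ball. -/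
theorem exists_fixed_point_of_norm_le_one {E : Type*} [NormedAddCommGroup E]
    [InnerProductSpace ℝ E] [FiniteDimensional ℝ E] {f : E → E} (hf : Continuous f)
    (hball : ∀ x, ‖f x‖ ≤ 1) : ∃ x, f x = x := by
  cases subsingleton_or_nontrivial E
  · exact ⟨0, Subsingleton.elim _ _⟩
  by_contra! hne
  obtain ⟨x₀, -, hmin⟩ := (isCompact_closedBall (0 : E) 1).exists_isMinOn ⟨0, by simp⟩
    (f := fun x ↦ ‖f x - x‖) (by fun_prop)
  have hm : 0 < ‖f x₀ - x₀‖ := norm_pos_iff.2 (sub_ne_zero.2 (hne x₀))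
  set ε := ‖f x₀ - x₀‖ / 3 with hε
  have hε0 : 0 < ε := by positivity
  obtain ⟨g, hg, hgf, -⟩ := hf.exists_contDiff_approx 1 (ε := fun _ ↦ ε) continuous_const
    (fun _ ↦ hε0)
  have hgn : ∀ x, ‖g x‖ ≤ 1 + ε := fun x ↦ by
    have h1 := norm_le_norm_add_norm_sub (f x) (g x)
    have h2 := hgf x
    rw [dist_eq_norm, norm_sub_rev] at h2
    linarith [hball x]
  obtain ⟨x, hx, hfix⟩ := exists_fixed_point_of_contDiff (f := fun x ↦ (1 + ε)⁻¹ • g x)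
    (contDiff_const.smul hg) (fun x ↦ by
      rw [norm_smul, Real.norm_of_nonneg (by positivity)]
      exact inv_mul_le_one_of_le₀ (hgn x) (by positivity))
  have hgx : g x = (1 + ε) • x := by
    rw [← hfix, smul_inv_smul₀ (by positivity : (1 + ε) ≠ 0)]
    simp only [hfix]
  have h1 : ‖g x - x‖ ≤ ε := by
    rw [hgx, add_smul, one_smul, add_sub_cancel_left, norm_smul, Real.norm_of_nonneg hε0.le]
    exact mul_le_of_le_one_right hε0.le (by simpa using hx)
  have h2 := hgf x
  rw [dist_eq_norm, norm_sub_rev] at h2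
  have h3 := norm_sub_le_norm_sub_add_norm_sub (f x) (g x) x
  have h4 : ‖f x₀ - x₀‖ ≤ ‖f x - x‖ := hmin hx
  linarith

/-- Brouwer's fixed point theorem for the standard simplex. -/
theorem exists_fixed_point_stdSimplex {ι : Type*} [Fintype ι] [Nonempty ι]
    {f : (ι → ℝ) → ι → ℝ} (hf : ContinuousOn f (stdSimplex ℝ ι))
    (hmaps : MapsTo f (stdSimplex ℝ ι) (stdSimplex ℝ ι)) : ∃ c ∈ stdSimplex ℝ ι, f c = c := by
  set S : (ι → ℝ) → ℝ := fun c ↦ ∑ i, max (c i) 0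
  set π : (ι → ℝ) → ι → ℝ :=
    fun c i ↦ (max (c i) 0 + max (1 - S c) 0 / Fintype.card ι) / max (S c) 1
  have hπ : Continuous π := by
    have hS : Continuous S := by fun_prop
    refine continuous_pi fun i ↦ ?_
    refine Continuous.div₀ (by fun_prop) (by fun_prop) fun c ↦ ?_
    exact (one_pos.trans_le (le_max_right _ _)).ne'
  have hπmem : ∀ c, π c ∈ stdSimplex ℝ ι := by
    intro c
    refine ⟨fun i ↦ by positivity, ?_⟩
    rw [← Finset.sum_div, Finset.sum_add_distrib, Finset.sum_const, Finset.card_univ,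
      nsmul_eq_mul, mul_div_cancel₀ _ (by positivity), div_eq_one_iff_eq (by positivity)]
    change S c + max (1 - S c) 0 = max (S c) 1
    rcases le_total (S c) 1 with h | h
    · rw [max_eq_left (by linarith), max_eq_right h]
      ring
    · rw [max_eq_right (by linarith), max_eq_left h]
      ring
  have hπid : ∀ c ∈ stdSimplex ℝ ι, π c = c := by
    intro c hc
    have hS : S c = 1 := by
      rw [← hc.2]
      exact Finset.sum_congr rfl fun i _ ↦ max_eq_left (hc.1 i)
    ext i
    simp [π, hS, hc.1 i]
  obtain ⟨x, hx⟩ := exists_fixed_point_of_norm_le_one (E := EuclideanSpace ℝ ι)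
    (f := fun x ↦ WithLp.toLp 2 (f (π x.ofLp)))
    ((PiLp.continuous_toLp 2 _).comp
      (hf.comp_continuous (hπ.comp (PiLp.continuous_ofLp 2 _)) fun x ↦ hπmem _))
    (fun x ↦ by
      have h := hmaps (hπmem x.ofLp)
      rw [EuclideanSpace.norm_eq, Real.sqrt_le_one, ← h.2]
      refine Finset.sum_le_sum fun i _ ↦ ?_
      have h0 := h.1 i
      have h1 : f (π x.ofLp) i ≤ 1 := by
        rw [← h.2]
        exact Finset.single_le_sum (fun j _ ↦ h.1 j) (Finset.mem_univ i)
      simp only [Real.norm_eq_abs, sq_abs]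
      nlinarith)
  have hx' : f (π x.ofLp) = x.ofLp := congrArg WithLp.ofLp hx
  have hmem : x.ofLp ∈ stdSimplex ℝ ι := by
    rw [← hx']
    exact hmaps (hπmem _)
  exact ⟨x.ofLp, hmem, by rwa [hπid _ hmem] at hx'⟩

theorem exists_norm_sub_le_of_mapsTo_isCompact {V : Type*} [NormedAddCommGroup V]
    [NormedSpace ℝ V] {C Q : Set V} (hC : Convex ℝ C) (hne : C.Nonempty) (hQ : IsCompact Q)
    (hQC : Q ⊆ C) {f : V → V} (hf : ContinuousOn f C) (hmaps : MapsTo f C Q) {ε : ℝ}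
    (hε : 0 < ε) : ∃ x ∈ C, ‖x - f x‖ ≤ ε := by
  obtain ⟨t, htQ, htf, hcov⟩ := hQ.finite_cover_balls hε
  lift t to Finset V using htf
  set φ : V → t → ℝ := fun z y ↦ max 0 (ε - dist z y)
  set S : V → ℝ := fun z ↦ ∑ y, φ z y
  have hS : ∀ z ∈ Q, 0 < S z := by
    intro z hz
    obtain ⟨y, hy, hzy⟩ := mem_iUnion₂.1 (hcov hz)
    refine Finset.sum_pos' (fun _ _ ↦ le_max_left _ _) ⟨⟨y, hy⟩, Finset.mem_univ _, ?_⟩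
    exact lt_max_of_lt_right (sub_pos.2 hzy)
  obtain ⟨x₀, hx₀⟩ := hne
  have : Nonempty t := by
    obtain ⟨y, hy, -⟩ := mem_iUnion₂.1 (hcov (hmaps hx₀))
    exact ⟨⟨y, hy⟩⟩
  set L : (t → ℝ) → V := fun c ↦ ∑ y, c y • (y : V)
  have hL : ∀ c ∈ stdSimplex ℝ t, L c ∈ C := fun c hc ↦
    hC.sum_mem (fun y _ ↦ hc.1 y) hc.2 fun y _ ↦ hQC (htQ y.2)
  obtain ⟨c, hc, hfix⟩ := exists_fixed_point_stdSimplex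
    (f := fun c y ↦ φ (f (L c)) y / S (f (L c)))
    (by
      have h1 : ContinuousOn (fun c ↦ f (L c)) (stdSimplex ℝ t) :=
        hf.comp (by fun_prop) hL
      have h2 : ∀ y, Continuous fun z ↦ φ z y := fun y ↦ by fun_prop
      refine continuousOn_pi.2 fun y ↦ ((h2 y).comp_continuousOn h1).div₀
        ((continuous_finsetSum _ fun y _ ↦ h2 y).comp_continuousOn h1) fun c hc ↦ ?_
      exact (hS _ (hmaps (hL c hc))).ne')
    (fun c hc ↦ by
      have h1 := hS _ (hmaps (hL c hc))
      refine ⟨fun y ↦ div_nonneg (le_max_left _ _) h1.le, ?_⟩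
      rw [← Finset.sum_div]
      exact div_self h1.ne')
  refine ⟨L c, hL c hc, ?_⟩
  have h1 : L c - f (L c) = ∑ y, c y • ((y : V) - f (L c)) := by
    simp_rw [smul_sub, Finset.sum_sub_distrib, ← Finset.sum_smul, hc.2, one_smul, L]
  calc ‖L c - f (L c)‖ ≤ ∑ y, ‖c y • ((y : V) - f (L c))‖ := h1 ▸ norm_sum_le _ _
    _ ≤ ∑ y, c y * ε := by
      refine Finset.sum_le_sum fun y _ ↦ ?_
      rw [norm_smul, Real.norm_of_nonneg (hc.1 y)]
      rcases (hc.1 y).eq_or_lt with h | h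
      · simp [← h]
      · refine mul_le_mul_of_nonneg_left ?_ h.le
        by_contra! hlt
        have h2 : φ (f (L c)) y = 0 := max_eq_left (by
          rw [dist_comm, dist_eq_norm]
          linarith)
        have h3 := congrFun hfix y
        simp only [h2, zero_div] at h3
        exact h.ne h3
    _ = ε := by rw [← Finset.sum_mul, hc.2, one_mul]

/-- Schauder's fixed point theorem. -/
theorem exists_fixed_point_of_mapsTo_isCompact {V : Type*} [NormedAddCommGroup V]
    [NormedSpace ℝ V] {C Q : Set V} (hC : Convex ℝ C) (hne : C.Nonempty) (hQ : IsCompact Q)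
    (hQC : Q ⊆ C) {f : V → V} (hf : ContinuousOn f C) (hmaps : MapsTo f C Q) :
    ∃ x ∈ C, f x = x := by
  have happ : ∀ n : ℕ, ∃ x ∈ C, ‖x - f x‖ ≤ 1 / ((n : ℝ) + 1) := fun n ↦
    exists_norm_sub_le_of_mapsTo_isCompact hC hne hQ hQC hf hmaps (by positivity)
  choose x hxC hx using happ
  obtain ⟨z, hzQ, ψ, hψ, hlim⟩ := hQ.tendsto_subseq fun n ↦ hmaps (hxC n)
  have h0 : Tendsto (fun n ↦ x n - f (x n)) atTop (𝓝 0) :=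
    squeeze_zero_norm hx tendsto_one_div_add_atTop_nhds_zero_nat
  have hxz : Tendsto (x ∘ ψ) atTop (𝓝 z) := by
    simpa [Function.comp_def] using (h0.comp hψ.tendsto_atTop).add hlim
  have hfz : Tendsto (fun n ↦ f (x (ψ n))) atTop (𝓝 (f z)) :=
    (hf z (hQC hzQ)).tendsto.comp (tendsto_nhdsWithin_iff.2 ⟨hxz, .of_forall fun n ↦ hxC _⟩)
  exact ⟨z, hQC hzQ, tendsto_nhds_unique hfz hlim⟩

theorem exists_strictMono_section {X : Type*} [NormedAddCommGroup X] [NormedSpace ℝ X] {K : Set X}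
    {h : X} (hh : h ≠ 0)
    (hmono : ∀ x ∈ K, ∀ s t : ℝ, 0 ≤ s → s < t → ‖x + s • h‖ < ‖x + t • h‖) (r : ℝ) :
    ∃ μ : X → ℝ, ContinuousOn μ K ∧ ∀ x ∈ K, 0 ≤ μ x ∧ ‖x + μ x • h‖ = max r ‖x‖ := by
  have hex : ∀ x : X, ∃ m : ℝ, 0 ≤ m ∧ ‖x + m • h‖ = max r ‖x‖ := by
    intro x
    have hh' := norm_pos_iff.2 hh
    set M := (max r ‖x‖ + ‖x‖) / ‖h‖
    have hM : 0 ≤ M := div_nonneg (add_nonneg ((norm_nonneg x).trans (le_max_right _ _))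
      (norm_nonneg x)) hh'.le
    have h1 : max r ‖x‖ ≤ ‖x + M • h‖ := by
      have h2 : ‖M • h‖ = max r ‖x‖ + ‖x‖ := by
        rw [norm_smul, Real.norm_of_nonneg hM, div_mul_cancel₀ _ hh'.ne']
      have h3 := norm_sub_le (x + M • h) x
      rw [add_sub_cancel_left] at h3
      linarith
    obtain ⟨m, hm, hmx⟩ := intermediate_value_Icc hM
      (f := fun m : ℝ ↦ ‖x + m • h‖) (by fun_prop) ⟨by simp, h1⟩
    exact ⟨m, hm.1, hmx⟩
  choose μ hμ0 hμ using hex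
  refine ⟨μ, fun x₀ hx₀ ↦ tendsto_order.2 ⟨fun a ha ↦ ?_, fun a ha ↦ ?_⟩,
    fun x _ ↦ ⟨hμ0 x, hμ x⟩⟩
  · rcases lt_or_ge a 0 with ha0 | ha0
    · exact .of_forall fun x ↦ ha0.trans_le (hμ0 x)
    have h1 : ‖x₀ + a • h‖ < max r ‖x₀‖ := hμ x₀ ▸ hmono x₀ hx₀ a _ ha0 ha
    have h2 : ∀ᶠ x in 𝓝 x₀, ‖x + a • h‖ < max r ‖x‖ :=
      ContinuousAt.eventually_lt (by fun_prop) (by fun_prop) h1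
    filter_upwards [nhdsWithin_le_nhds h2, self_mem_nhdsWithin] with x hx hxK
    by_contra! hle
    rcases hle.lt_or_eq with hlt | heq
    · have h3 := hmono x hxK _ _ (hμ0 x) hlt
      rw [hμ x] at h3
      exact lt_asymm h3 hx
    · rw [← heq, hμ x] at hx
      exact lt_irrefl _ hx
  · have h1 : max r ‖x₀‖ < ‖x₀ + a • h‖ := hμ x₀ ▸ hmono x₀ hx₀ _ a (hμ0 x₀) ha
    have h2 : ∀ᶠ x in 𝓝 x₀, max r ‖x‖ < ‖x + a • h‖ :=
      ContinuousAt.eventually_lt (by fun_prop) (by fun_prop) h1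
    filter_upwards [nhdsWithin_le_nhds h2, self_mem_nhdsWithin] with x hx hxK
    by_contra! hle
    rcases hle.lt_or_eq with hlt | heq
    · have h3 := hmono x hxK _ _ ((hμ0 x₀).trans ha.le) hlt
      rw [hμ x] at h3
      exact lt_asymm h3 hx
    · rw [heq, hμ x] at hx
      exact lt_irrefl _ hx

/-- In a cone whose norm is strictly monotone there is a continuous retraction onto the conical
shell `r ≤ ‖x‖ ≤ R` that pushes points of norm less than `r` in the direction `h` and points
of norm greater than `R` radially. -/
theorem IsCone.exists_shell_retraction {X : Type*} [NormedAddCommGroup X] [NormedSpace ℝ X]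
    {K : Set X} (hK : IsCone K)
    (hpres : ∀ x ∈ K, ∀ y ∈ K, y - x ∈ K \ {0} → ‖x‖ < ‖y‖) {r R : ℝ} (hr : 0 < r) (hR : r < R)
    {h : X} (hhK : h ∈ K) (hh : h ≠ 0) :
    ∃ ρ : X → X, ContinuousOn ρ K ∧ ∀ x ∈ K, ρ x ∈ K ∧ r ≤ ‖ρ x‖ ∧ ‖ρ x‖ ≤ R ∧
      (ρ x = x ∨ (‖ρ x‖ = r ∧ ∃ m : ℝ, 0 < m ∧ x + m • h = ρ x) ∨
        (‖ρ x‖ = R ∧ ∃ l : ℝ, 1 < l ∧ x = l • ρ x)) := by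
  obtain ⟨-, -, hconv, hsmul, -⟩ := hK
  have hadd : ∀ x ∈ K, ∀ m : ℝ, 0 ≤ m → x + m • h ∈ K := by
    intro x hx m hm
    have h1 := hsmul _ (hconv hx (hsmul h hhK m hm) (a := 2⁻¹) (b := 2⁻¹) (by norm_num)
      (by norm_num) (by norm_num)) 2 (by norm_num)
    rwa [smul_add, smul_inv_smul₀ two_ne_zero, smul_inv_smul₀ two_ne_zero] at h1
  obtain ⟨μ, hμc, hμ⟩ := exists_strictMono_section (K := K) hh (fun x hx s t hs hst ↦ by
    refine hpres _ (hadd x hx s hs) _ (hadd x hx t (hs.trans hst.le)) ?_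
    rw [add_sub_add_left_eq_sub, ← sub_smul]
    exact ⟨hsmul h hhK _ (sub_pos.2 hst).le, smul_ne_zero (sub_pos.2 hst).ne' hh⟩) r
  set σ : X → X := fun x ↦ x + μ x • h
  have hσc : ContinuousOn σ K := continuousOn_id.add (hμc.smul continuousOn_const)
  have hσ : ∀ x ∈ K, ‖σ x‖ = max r ‖x‖ := fun x hx ↦ (hμ x hx).2
  have hσr : ∀ x ∈ K, r ≤ ‖σ x‖ := fun x hx ↦ hσ x hx ▸ le_max_left _ _
  have hσpos : ∀ x ∈ K, 0 < ‖σ x‖ := fun x hx ↦ hr.trans_le (hσr x hx)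
  have hσeq : ∀ x ∈ K, r ≤ ‖x‖ → σ x = x := by
    intro x hx hrx
    by_contra hne
    have hmne : μ x ≠ 0 := fun h0 ↦ hne (by simp [σ, h0])
    have hm : 0 < μ x := (hμ x hx).1.lt_of_ne' hmne
    have h1 := hpres x hx (σ x) (hadd x hx _ hm.le)
      (by simpa [σ] using ⟨hsmul h hhK _ hm.le, hmne, hh⟩)
    rw [hσ x hx, max_eq_right hrx] at h1
    exact lt_irrefl _ h1
  refine ⟨fun x ↦ min 1 (R / ‖σ x‖) • σ x, ?_, fun x hx ↦ ?_⟩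
  · exact (continuousOn_const.inf (continuousOn_const.div₀ hσc.norm
      fun x hx ↦ (hσpos x hx).ne')).smul hσc
  have hσK : σ x ∈ K := hadd x hx _ (hμ x hx).1
  have hR0 : 0 < R := hr.trans hR
  beta_reduce
  refine ⟨hsmul _ hσK _ (by positivity), ?_⟩
  rcases le_or_gt ‖σ x‖ R with hle | hlt
  · rw [min_eq_left ((one_le_div (hσpos x hx)).2 hle), one_smul]
    refine ⟨hσr x hx, hle, ?_⟩
    rcases le_or_gt r ‖x‖ with hrx | hrx
    · exact .inl (hσeq x hx hrx)
    · have h1 : ‖σ x‖ = r := by rw [hσ x hx, max_eq_left hrx.le]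
      refine .inr (.inl ⟨h1, μ x, (hμ x hx).1.lt_of_ne' fun h0 ↦ ?_, rfl⟩)
      simp only [σ, h0, zero_smul, add_zero] at h1
      exact hrx.ne h1
  · have hxR : R < ‖x‖ := by
      rw [hσ x hx, lt_max_iff] at hlt
      exact hlt.resolve_left hR.le.not_gt
    have hx0 : 0 < ‖x‖ := hR0.trans hxR
    rw [hσeq x hx (hR.trans hxR).le, min_eq_right ((div_le_one hx0).2 hxR.le)]
    have h1 : ‖(R / ‖x‖) • x‖ = R := by
      rw [norm_smul, Real.norm_of_nonneg (by positivity), div_mul_cancel₀ _ hx0.ne']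
    refine ⟨by rw [h1]; exact hR.le, h1.le, .inr (.inr ⟨h1, ‖x‖ / R, (one_lt_div hR0).2 hxR, ?_⟩)⟩
    rw [smul_smul, div_mul_div_cancel₀ hR0.ne', div_self hx0.ne', one_smul]

theorem exists_fixed_point_homotopy_compression
    {X Y : Type*} [NormedAddCommGroup X] [NormedSpace ℝ X]
    [NormedAddCommGroup Y] [NormedSpace ℝ Y]
    {K₁ : Set X} {K₂ : Set Y} (hK₁ : IsCone K₁) (hK₂ : IsCone K₂)
    (hpres₁ : ∀ x ∈ K₁, ∀ y ∈ K₁, y - x ∈ K₁ \ {0} → ‖x‖ < ‖y‖)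
    (hpres₂ : ∀ x ∈ K₂, ∀ y ∈ K₂, y - x ∈ K₂ \ {0} → ‖x‖ < ‖y‖)
    {r₁ r₂ R₁ R₂ : ℝ} (hr₁ : 0 < r₁) (hR₁ : r₁ < R₁) (hr₂ : 0 < r₂) (hR₂ : r₂ < R₂)
    (T₁ : X × Y → X) (T₂ : X × Y → Y)
    (hmap : ∀ p ∈ KrR K₁ K₂ r₁ r₂ R₁ R₂, T₁ p ∈ K₁ ∧ T₂ p ∈ K₂)
    (hcont : ContinuousOn (fun p => (T₁ p, T₂ p)) (KrR K₁ K₂ r₁ r₂ R₁ R₂))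
    (hcpt : IsCompact (closure ((fun p => (T₁ p, T₂ p)) '' (KrR K₁ K₂ r₁ r₂ R₁ R₂))))
    (hyp₁ : ∃ h₁ ∈ K₁, h₁ ≠ 0 ∧
      ∀ p ∈ KrR K₁ K₂ r₁ r₂ R₁ R₂,
        (‖p.1‖ = r₁ → ∀ μ : ℝ, 0 < μ → T₁ p + μ • h₁ ≠ p.1) ∧
        (‖p.1‖ = R₁ → ∀ l : ℝ, 1 < l → T₁ p ≠ l • p.1))
    (hyp₂ : ∃ h₂ ∈ K₂, h₂ ≠ 0 ∧
      ∀ p ∈ KrR K₁ K₂ r₁ r₂ R₁ R₂,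
        (‖p.2‖ = r₂ → ∀ μ : ℝ, 0 < μ → T₂ p + μ • h₂ ≠ p.2) ∧
        (‖p.2‖ = R₂ → ∀ l : ℝ, 1 < l → T₂ p ≠ l • p.2)) :
    ∃ p ∈ KrR K₁ K₂ r₁ r₂ R₁ R₂, T₁ p = p.1 ∧ T₂ p = p.2 := by
  obtain ⟨h₁, hh₁K, hh₁, hyp₁⟩ := hyp₁
  obtain ⟨h₂, hh₂K, hh₂, hyp₂⟩ := hyp₂
  obtain ⟨ρ₁, hρ₁c, hρ₁⟩ := hK₁.exists_shell_retraction hpres₁ hr₁ hR₁ hh₁K hh₁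
  obtain ⟨ρ₂, hρ₂c, hρ₂⟩ := hK₂.exists_shell_retraction hpres₂ hr₂ hR₂ hh₂K hh₂
  set ρ : X × Y → X × Y := fun p ↦ (ρ₁ p.1, ρ₂ p.2)
  have hρmem : MapsTo ρ (K₁ ×ˢ K₂) (KrR K₁ K₂ r₁ r₂ R₁ R₂) := fun p hp ↦
    ⟨(hρ₁ _ hp.1).1, (hρ₂ _ hp.2).1, (hρ₁ _ hp.1).2.1, (hρ₁ _ hp.1).2.2.1,
      (hρ₂ _ hp.2).2.1, (hρ₂ _ hp.2).2.2.1⟩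
  have hρc : ContinuousOn ρ (K₁ ×ˢ K₂) :=
    (hρ₁c.comp continuousOn_fst fun p hp ↦ hp.1).prodMk
      (hρ₂c.comp continuousOn_snd fun p hp ↦ hp.2)
  obtain ⟨p, hp, hfix⟩ := exists_fixed_point_of_mapsTo_isCompact (hK₁.2.2.1.prod hK₂.2.2.1)
    (hK₁.1.prod hK₂.1) hcpt
    (closure_minimal (image_subset_iff.2 hmap) (hK₁.2.1.prod hK₂.2.1))
    (hcont.comp hρc hρmem) (fun p hp ↦ subset_closure (mem_image_of_mem _ (hρmem hp)))
  have hfix₁ : T₁ (ρ p) = p.1 := congrArg Prod.fst hfix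
  have hfix₂ : T₂ (ρ p) = p.2 := congrArg Prod.snd hfix
  have hρp := hρmem hp
  have heq₁ : ρ₁ p.1 = p.1 := by
    obtain ⟨-, -, -, h | ⟨hn, m, hm, h⟩ | ⟨hn, l, hl, h⟩⟩ := hρ₁ p.1 hp.1
    · exact h
    · exact absurd (hfix₁ ▸ h) ((hyp₁ _ hρp).1 hn m hm)
    · exact absurd (hfix₁.trans h) ((hyp₁ _ hρp).2 hn l hl)
  have heq₂ : ρ₂ p.2 = p.2 := by
    obtain ⟨-, -, -, h | ⟨hn, m, hm, h⟩ | ⟨hn, l, hl, h⟩⟩ := hρ₂ p.2 hp.2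
    · exact h
    · exact absurd (hfix₂ ▸ h) ((hyp₂ _ hρp).1 hn m hm)
    · exact absurd (hfix₂.trans h) ((hyp₂ _ hρp).2 hn l hl)
  have heq : ρ p = p := Prod.ext heq₁ heq₂
  rw [heq] at hρp hfix₁ hfix₂
  exact ⟨p, hρp, hfix₁, hfix₂⟩
end

section
/- (Existence of a coexistence positive solution via eigenvalue criteria) Let μ₁ = π²/4 and let f₁, f₂ : [0,1] × [0,∞) × [0,∞) → [0,∞) be continuous functions such that: (H) for each i ∈ {1,2} and each M > 0 there exists C > 0 with fᵢ(t,x₁,x₂) ≤ C whenever xᵢ ∈ [0,M], x_j ∈ [0,∞) (j ≠ i) and t ∈ [0,1]; for each i ∈ {1,2} there exist εᵢ > 0 and δᵢ > 0 such that fᵢ(t,x₁,x₂) ≥ (μ₁ + εᵢ)·xᵢ for all xᵢ ∈ [0,δᵢ], all x_j ≥ 0 (j ≠ i) and all t ∈ [0,1]; and for each i ∈ {1,2} there exist ε'ᵢ ∈ (0,μ₁) and Mᵢ > 0 such that fᵢ(t,x₁,x₂) ≤ (μ₁ − ε'ᵢ)·xᵢ for all xᵢ ≥ Mᵢ, all x_j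 ≥ 0 (j ≠ i) and all t ∈ [0,1]. Then there exist twice continuously differentiable functions x, y : [0,1] → [0,∞), neither identically zero, such that x''(t) + f₁(t, x(t), y(t)) = 0 and y''(t) + f₂(t, x(t), y(t)) = 0 for all t ∈ [0,1], and x'(0) = x(1) = y'(0) = y(1) = 0. -/
open Set Real

open Filter Topology

/-- A Sperner-type lemma for a three-coloured square grid. -/
theorem exists_trichromatic_cell {N : ℕ} (c : ℕ → ℕ → Fin 3)
    (left : ∀ j ≤ N, c 0 j = 1) (right : ∀ j ≤ N, c N j ≠ 1)
    (bottom : ∀ i ≤ N, c i 0 ≠ 0) (top : ∀ i ≤ N, c i N ≠ 2) :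
    ∃ i < N, ∃ j < N, ∀ k, k = c i j ∨ k = c (i + 1) j ∨ k = c i (j + 1) ∨
      k = c (i + 1) (j + 1) := by
  by_contra! hcon
  let e : Fin 3 → Fin 3 → ZMod 2 := fun a b =>
    if (a = 0 ∧ b = 1) ∨ (a = 1 ∧ b = 0) then 1 else 0
  have cell : ∀ p q r s : Fin 3,
      (∃ k, k ≠ p ∧ k ≠ q ∧ k ≠ r ∧ k ≠ s) → e p q + e r s = e q s - e p r := by
    decide
  have zero_of_ne_one : ∀ p q : Fin 3, p ≠ 1 → q ≠ 1 → e p q = 0 := by decide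
  have zero_of_ne_zero : ∀ p q : Fin 3, p ≠ 0 → q ≠ 0 → e p q = 0 := by decide
  have diff : ∀ p q : Fin 3, p ≠ 2 → q ≠ 2 →
      e p q = (if q = 0 then 1 else 0) - (if p = 0 then 1 else 0) := by decide
  have eq_of_add : ∀ x y : ZMod 2, x + y = 0 → x = y := by decide
  have row : ∀ j ≤ N, ∑ i ∈ Finset.range N, e (c i j) (c (i + 1) j) = 0 := by
    intro j
    induction j with
    | zero =>
      intro _
      refine Finset.sum_eq_zero fun i hi => ?_
      have := Finset.mem_range.1 hi
      exact zero_of_ne_zero _ _ (bottom _ (by lia)) (bottom _ (by lia))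
    | succ j ih =>
      intro hj
      rw [← ih (by lia)]
      refine (eq_of_add _ _ ?_).symm
      rw [← Finset.sum_add_distrib]
      have h : ∀ i ∈ Finset.range N,
          e (c i j) (c (i + 1) j) + e (c i (j + 1)) (c (i + 1) (j + 1)) =
          e (c (i + 1) j) (c (i + 1) (j + 1)) - e (c i j) (c i (j + 1)) := fun i hi =>
        cell _ _ _ _ (hcon i (Finset.mem_range.1 hi) j (by lia))
      rw [Finset.sum_congr rfl h, Finset.sum_range_sub (fun i => e (c i j) (c i (j + 1))),
        left _ (by lia), left _ hj, zero_of_ne_one _ _ (right _ (by lia)) (right _ hj)]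
      decide
  have hN := row N le_rfl
  have h : ∀ i ∈ Finset.range N, e (c i N) (c (i + 1) N) =
      (if c (i + 1) N = 0 then 1 else 0) - (if c i N = 0 then 1 else 0) := fun i hi => by
    have := Finset.mem_range.1 hi
    exact diff _ _ (top _ (by lia)) (top _ (by lia))
  rw [Finset.sum_congr rfl h,
    Finset.sum_range_sub (fun i => if c i N = 0 then (1 : ZMod 2) else 0), left _ le_rfl] at hN
  have hNN : ∀ p : Fin 3, p ≠ 1 → p ≠ 2 → p = 0 := by decide
  rw [hNN _ (right _ le_rfl) (top _ le_rfl)] at hN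
  exact absurd hN (by decide)

/-- The Poincaré–Miranda theorem in the plane. -/
theorem exists_zero_of_sign_change_on_square {R : ℝ} (hR : 0 < R) {G : ℝ × ℝ → ℝ × ℝ}
    (hG : Continuous G) (left : ∀ b ∈ Icc (-R) R, (G (-R, b)).1 < 0)
    (right : ∀ b ∈ Icc (-R) R, 0 < (G (R, b)).1)
    (bottom : ∀ a ∈ Icc (-R) R, (G (a, -R)).2 < 0)
    (top : ∀ a ∈ Icc (-R) R, 0 < (G (a, R)).2) :
    ∃ p ∈ Icc (-R) R ×ˢ Icc (-R) R, G p = 0 := by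
  by_contra! hcon
  let color : ℝ × ℝ → Fin 3 := fun q => if q.1 < 0 then 1 else if q.2 < 0 then 2 else 0
  have color_zero : ∀ q, color q = 0 → 0 ≤ q.1 ∧ 0 ≤ q.2 := fun q => by
    simp only [color]; split_ifs <;> simp_all
  have color_one : ∀ q, color q = 1 → q.1 < 0 := fun q => by
    simp only [color]; split_ifs <;> simp_all
  have color_two : ∀ q, color q = 2 → q.2 < 0 := fun q => by
    simp only [color]; split_ifs <;> simp_all
  have hK : IsCompact (Icc (-R) R ×ˢ Icc (-R) R) := isCompact_Icc.prod isCompact_Icc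
  obtain ⟨p₀, hp₀, hmin⟩ := hK.exists_isMinOn ⟨(R, R), by simp [hR.le]⟩ hG.norm.continuousOn
  have hm : 0 < ‖G p₀‖ := norm_pos_iff.2 (hcon p₀ hp₀)
  obtain ⟨δ, hδ, hunif⟩ := Metric.uniformContinuousOn_iff.1
    (hK.uniformContinuousOn_of_continuous hG.continuousOn) _ hm
  obtain ⟨N, hN⟩ := exists_nat_gt (2 * R / δ)
  have hN0 : (0 : ℝ) < N := lt_of_le_of_lt (by positivity) hN
  have hstep : 2 * R / N < δ := by
    rw [div_lt_iff₀ hδ] at hN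
    rw [div_lt_iff₀ hN0]
    linarith
  let x : ℕ → ℝ := fun i => -R + 2 * R / N * i
  have hx0 : x 0 = -R := by simp [x]
  have hxN : x N = R := by simp only [x]; field_simp; ring
  have hxmem : ∀ i ≤ N, x i ∈ Icc (-R) R := fun i hi => by
    have hi' : (i : ℝ) ≤ N := by exact_mod_cast hi
    have h0 : 0 ≤ 2 * R / N * i := by positivity
    have h1 : 2 * R / N * i ≤ 2 * R / N * N := by gcongr
    rw [div_mul_cancel₀ _ hN0.ne'] at h1
    exact ⟨by simp only [x]; linarith, by simp only [x]; linarith⟩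
  let c : ℕ → ℕ → Fin 3 := fun i j => color (G (x i, x j))
  obtain ⟨i, hi, j, hj, htri⟩ := exists_trichromatic_cell (N := N) c
    (fun j hj => by simp [c, color, hx0, left _ (hxmem j hj)])
    (fun j hj h => by
      have h' := color_one _ h
      rw [hxN] at h'
      exact h'.not_gt (right _ (hxmem j hj)))
    (fun i hi h => by
      have h' := (color_zero _ h).2
      rw [hx0] at h'
      exact h'.not_gt (bottom _ (hxmem i hi)))
    (fun i hi h => by
      have h' := color_two _ h
      rw [hxN] at h'
      exact h'.not_gt (top _ (hxmem i hi)))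
  have key : ∀ k, ∃ a b : ℕ, (a = i ∨ a = i + 1) ∧ (b = j ∨ b = j + 1) ∧ c a b = k := by
    intro k
    rcases htri k with h | h | h | h
    exacts [⟨i, j, by simp, by simp, h.symm⟩, ⟨i + 1, j, by simp, by simp, h.symm⟩,
      ⟨i, j + 1, by simp, by simp, h.symm⟩, ⟨i + 1, j + 1, by simp, by simp, h.symm⟩]
  have hclose : ∀ {k a b : ℕ}, (a = k ∨ a = k + 1) → (b = k ∨ b = k + 1) →
      dist (x a) (x b) < δ := by
    intro k a b ha hb
    have hpos : 0 < 2 * R / N := by positivity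
    rw [Real.dist_eq, abs_lt]
    rcases ha with rfl | rfl <;> rcases hb with rfl | rfl <;> simp only [x] <;> push_cast <;>
      constructor <;> nlinarith
  have hmem : ∀ {a b : ℕ}, (a = i ∨ a = i + 1) → (b = j ∨ b = j + 1) →
      (x a, x b) ∈ Icc (-R) R ×ˢ Icc (-R) R := fun ha hb =>
    ⟨hxmem _ (by lia), hxmem _ (by lia)⟩
  obtain ⟨a₀, b₀, ha₀, hb₀, h₀⟩ := key 0
  obtain ⟨a₁, b₁, ha₁, hb₁, h₁⟩ := key 1
  obtain ⟨a₂, b₂, ha₂, hb₂, h₂⟩ := key 2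
  have d₁ := hunif _ (hmem ha₀ hb₀) _ (hmem ha₁ hb₁)
    (max_lt (hclose ha₀ ha₁) (hclose hb₀ hb₁))
  have d₂ := hunif _ (hmem ha₀ hb₀) _ (hmem ha₂ hb₂)
    (max_lt (hclose ha₀ ha₂) (hclose hb₀ hb₂))
  have s₀ := color_zero _ h₀
  have s₁ := color_one _ h₁
  have s₂ := color_two _ h₂
  rw [Prod.dist_eq, max_lt_iff, Real.dist_eq, Real.dist_eq] at d₁ d₂
  have e₁ := (abs_lt.1 d₁.1).2
  have e₂ := (abs_lt.1 d₂.2).2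
  refine absurd (isMinOn_iff.1 hmin _ (hmem ha₀ hb₀)) (not_le.2 ?_)
  rw [Prod.norm_def (G (x a₀, x b₀))]
  refine max_lt ?_ ?_ <;> rw [Real.norm_eq_abs, abs_lt] <;> constructor <;> linarith [s₀.1, s₀.2]

section DelayEquation

variable {E : Type*} [NormedAddCommGroup E] [NormedSpace ℝ E]

/-- Successive approximations for the delayed integral equation
`z t = p - ∫ r in 0..t, ∫ s in 0..r, F s (z (s - h))` with constant history `p`. -/
noncomputable def delayIterate (F : ℝ → E → E) (h : ℝ) : ℕ → E → ℝ → E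
  | 0, p, _ => p
  | n + 1, p, t => p - ∫ r in 0..t, ∫ s in 0..r, F s (delayIterate F h n p (max (s - h) 0))

theorem continuous_delayIterate {F : ℝ → E → E} (hF : Continuous (Function.uncurry F)) (h : ℝ)
    (n : ℕ) : Continuous (Function.uncurry (delayIterate F h n)) := by
  induction n with
  | zero => exact continuous_fst
  | succ n ih =>
    have h₀ : Continuous (fun q : E × ℝ => F q.2 (delayIterate F h n q.1 (max (q.2 - h) 0))) :=
      hF.comp (continuous_snd.prodMk (ih.comp (by fun_prop :
        Continuous fun q : E × ℝ => (q.1, max (q.2 - h) 0))))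
    have h₁ := intervalIntegral.continuous_parametric_primitive_of_continuous
      (μ := MeasureTheory.volume) (a₀ := 0)
      (f := fun p s => F s (delayIterate F h n p (max (s - h) 0))) h₀
    have h₂ := intervalIntegral.continuous_parametric_primitive_of_continuous
      (μ := MeasureTheory.volume) (a₀ := 0)
      (f := fun p r => ∫ s in 0..r, F s (delayIterate F h n p (max (s - h) 0))) h₁
    exact continuous_fst.sub h₂

theorem delayIterate_succ_eq (F : ℝ → E → E) {h : ℝ} (hh : 0 < h) (p : E) (n : ℕ) :
    ∀ t, 0 ≤ t → t ≤ n * h → delayIterate F h (n + 1) p t = delayIterate F h n p t := by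
  induction n with
  | zero =>
    intro t ht ht'
    obtain rfl : t = 0 := le_antisymm (by simpa using ht') ht
    simp [delayIterate]
  | succ n ih =>
    intro t ht ht'
    push_cast at ht'
    rw [delayIterate.eq_2 F h p t (n + 1), delayIterate.eq_2 F h p t n]
    congr 1
    refine intervalIntegral.integral_congr fun r hr => ?_
    rw [uIcc_of_le ht] at hr
    refine intervalIntegral.integral_congr fun s hs => ?_
    rw [uIcc_of_le hr.1] at hs
    have hnh : 0 ≤ n * h := by positivity
    rw [ih _ (le_max_right _ _) (max_le (by linarith [hr.2, hs.2]) hnh)]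

theorem norm_iterated_integral_le {g : ℝ → E} {C : ℝ} (hC : ∀ s, ‖g s‖ ≤ C) {t : ℝ}
    (ht : t ∈ Icc (0 : ℝ) 1) :
    ‖∫ s in 0..t, g s‖ ≤ C ∧ ‖∫ r in 0..t, ∫ s in 0..r, g s‖ ≤ C := by
  have hC0 : 0 ≤ C := (norm_nonneg _).trans (hC 0)
  have h : ∀ {k : ℝ → E}, ∀ r ∈ Icc (0 : ℝ) 1, (∀ s ∈ Icc (0 : ℝ) r, ‖k s‖ ≤ C) →
      ‖∫ s in 0..r, k s‖ ≤ C := by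
    intro k r hr hk
    refine (intervalIntegral.norm_integral_le_of_norm_le_const (C := C) fun s hs => ?_).trans ?_
    · rw [uIoc_of_le hr.1] at hs
      exact hk s ⟨hs.1.le, hs.2⟩
    · rw [sub_zero, abs_of_nonneg hr.1]
      exact mul_le_of_le_one_right hC0 hr.2
  have h' : ∀ r ∈ Icc (0 : ℝ) 1, ‖∫ s in 0..r, g s‖ ≤ C := fun r hr => h r hr fun s _ => hC s
  exact ⟨h' t ht, h t ht fun r hr => h' r ⟨hr.1, hr.2.trans ht.2⟩⟩

variable [CompleteSpace E]

theorem hasDerivAt_sub_iterated_integral {g : ℝ → E} (hg : Continuous g) (p : E) (t : ℝ) :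
    HasDerivAt (fun t => p - ∫ r in 0..t, ∫ s in 0..r, g s) (-∫ s in 0..t, g s) t := by
  have hG : Continuous fun r => ∫ s in 0..r, g s :=
    intervalIntegral.continuous_primitive (fun a b => hg.intervalIntegrable a b) 0
  exact (hG.integral_hasStrictDerivAt 0 t).hasDerivAt.const_sub p

theorem norm_sub_le_of_iterated_integral {g : ℝ → E} (hg : Continuous g) {C : ℝ}
    (hC : ∀ s, ‖g s‖ ≤ C) (p : E) {t t' : ℝ} (ht : t ∈ Icc (0 : ℝ) 1) (ht' : t' ∈ Icc (0 : ℝ) 1) :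
    ‖(p - ∫ r in 0..t, ∫ s in 0..r, g s) - (p - ∫ r in 0..t', ∫ s in 0..r, g s)‖ ≤
      C * |t - t'| :=
  (convex_Icc (0 : ℝ) 1).norm_image_sub_le_of_norm_hasDerivWithin_le
    (fun r _ => (hasDerivAt_sub_iterated_integral hg p r).hasDerivWithinAt)
    (fun r hr => by rw [norm_neg]; exact (norm_iterated_integral_le hC hr).1) ht' ht

end DelayEquation

/-- A version of the Arzelà–Ascoli theorem for uniformly Lipschitz sequences on `[0, 1]`. -/
theorem exists_subseq_tendsto_of_lipschitz {E : Type*} [NormedAddCommGroup E] [ProperSpace E]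
    {u : ℕ → ℝ → E} {B C : ℝ} (hB : ∀ n, ∀ t ∈ Icc (0 : ℝ) 1, ‖u n t‖ ≤ B)
    (hC : ∀ n, ∀ t ∈ Icc (0 : ℝ) 1, ∀ t' ∈ Icc (0 : ℝ) 1, ‖u n t - u n t'‖ ≤ C * |t - t'|) :
    ∃ z : ℝ → E, Continuous z ∧ ∃ φ : ℕ → ℕ, StrictMono φ ∧
      ∀ t ∈ Icc (0 : ℝ) 1, Tendsto (fun n => u (φ n) t) atTop (𝓝 (z t)) := by
  have hlip : ∀ n, ∀ t t' : Icc (0 : ℝ) 1, dist (u n t) (u n t') ≤ C * dist t t' :=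
    fun n t t' => by
      rw [dist_eq_norm, Subtype.dist_eq, Real.dist_eq]
      exact hC n t t.2 t' t'.2
  have hC' : Tendsto (fun r : ℝ => C * r) (𝓝 0) (𝓝 0) := by
    simpa using (tendsto_id (x := 𝓝 (0 : ℝ))).const_mul C
  have hcont : ∀ n, Continuous fun t : Icc (0 : ℝ) 1 => u n t := fun n =>
    (Metric.equicontinuous_of_continuity_modulus (fun r => C * r) hC'
      (fun _ : Unit => fun t : Icc (0 : ℝ) 1 => u n t) fun t t' _ => hlip n t t').continuous ()
  let v : ℕ → BoundedContinuousFunction (Icc (0 : ℝ) 1) E := fun n =>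
    BoundedContinuousFunction.mkOfCompact ⟨_, hcont n⟩
  have hcomp : IsCompact (closure (range v)) := by
    refine BoundedContinuousFunction.arzela_ascoli (Metric.closedBall 0 B)
      (isCompact_closedBall 0 B) _ ?_ ?_
    · rintro _ t ⟨n, rfl⟩
      exact mem_closedBall_zero_iff.2 (hB n t t.2)
    · refine Metric.equicontinuous_of_continuity_modulus (fun r => C * r) hC' _ ?_
      rintro t t' ⟨_, n, rfl⟩
      exact hlip n t t'
  obtain ⟨w, -, φ, hφ, hw⟩ := hcomp.tendsto_subseq fun n => subset_closure (mem_range_self n)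
  refine ⟨fun t => w (projIcc 0 1 zero_le_one t), by fun_prop, φ, hφ, fun t ht => ?_⟩
  have h := (BoundedContinuousFunction.tendsto_iff_tendstoUniformly.1 hw).tendsto_at ⟨t, ht⟩
  simp only [projIcc_of_mem _ ht]
  exact h

/-- Existence for `z'' = -F t z`, `z' 0 = 0`, `z 1 = 0` with a bounded continuous planar
nonlinearity `F`. -/
theorem exists_neumann_dirichlet_solution {F : ℝ → ℝ × ℝ → ℝ × ℝ}
    (hF : Continuous (Function.uncurry F)) {C : ℝ} (hC : ∀ t z, ‖F t z‖ ≤ C) :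
    ∃ z z' g : ℝ → ℝ × ℝ, Continuous g ∧ (∀ t, HasDerivAt z (z' t) t) ∧
      (∀ t, HasDerivAt z' (-g t) t) ∧ (∀ t ∈ Icc (0 : ℝ) 1, g t = F t (z t)) ∧
      z' 0 = 0 ∧ z 1 = 0 := by
  have hC0 : 0 ≤ C := (norm_nonneg _).trans (hC 0 0)
  have happrox : ∀ n : ℕ, ∃ p : ℝ × ℝ, ∃ u : ℝ → ℝ × ℝ, ‖p‖ ≤ C + 1 ∧ Continuous u ∧ u 1 = 0 ∧
      ∀ t ∈ Icc (0 : ℝ) 1,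
        u t = p - ∫ r in 0..t, ∫ s in 0..r, F s (u (max (s - 1 / (n + 1)) 0)) := by
    intro n
    have hh : (0 : ℝ) < 1 / (n + 1) := by positivity
    set h : ℝ := 1 / (n + 1)
    have hcont := continuous_delayIterate hF h (n + 1)
    have hshoot : Continuous fun p => delayIterate F h (n + 1) p 1 :=
      hcont.comp (continuous_id.prodMk continuous_const)
    have hdist : ∀ p, ‖p - delayIterate F h (n + 1) p 1‖ ≤ C := fun p => by
      rw [delayIterate, sub_sub_cancel]
      exact (norm_iterated_integral_le (fun s => hC _ _) ⟨zero_le_one, le_rfl⟩).2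
    have hfst : ∀ p, |p.1 - (delayIterate F h (n + 1) p 1).1| ≤ C := fun p =>
      (norm_fst_le _).trans (hdist p)
    have hsnd : ∀ p, |p.2 - (delayIterate F h (n + 1) p 1).2| ≤ C := fun p =>
      (norm_snd_le _).trans (hdist p)
    obtain ⟨p, hp, hp0⟩ := exists_zero_of_sign_change_on_square (R := C + 1) (by linarith) hshoot
      (fun b _ => by have := abs_le.1 (hfst (-(C + 1), b)); dsimp only at this; linarith)
      (fun b _ => by have := abs_le.1 (hfst (C + 1, b)); dsimp only at this; linarith)
      (fun a _ => by have := abs_le.1 (hsnd (a, -(C + 1))); dsimp only at this; linarith)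
      (fun a _ => by have := abs_le.1 (hsnd (a, C + 1)); dsimp only at this; linarith)
    refine ⟨p, delayIterate F h (n + 1) p, ?_, hcont.comp (Continuous.prodMk_right p), hp0,
      fun t ht => ?_⟩
    · rw [Prod.norm_def]
      exact max_le (abs_le.2 hp.1) (abs_le.2 hp.2)
    · rw [← delayIterate_succ_eq F hh p (n + 1) t ht.1]
      · rw [delayIterate]
      · have : ((n + 1 : ℕ) : ℝ) * h = 1 := by
          simp only [h]; push_cast; field_simp
        rw [this]
        exact ht.2
  choose p u hp hucont hu1 hu using happrox
  have hgcont : ∀ n, Continuous fun s => F s (u n (max (s - 1 / (n + 1)) 0)) := fun n =>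
    hF.comp (continuous_id.prodMk ((hucont n).comp (by fun_prop)))
  have hlip : ∀ n, ∀ t ∈ Icc (0 : ℝ) 1, ∀ t' ∈ Icc (0 : ℝ) 1,
      ‖u n t - u n t'‖ ≤ C * |t - t'| := fun n t ht t' ht' => by
    rw [hu n t ht, hu n t' ht']
    exact norm_sub_le_of_iterated_integral (hgcont n) (fun s => hC _ _) _ ht ht'
  have hbound : ∀ n, ∀ t ∈ Icc (0 : ℝ) 1, ‖u n t‖ ≤ C + 1 + C := fun n t ht => by
    rw [hu n t ht]
    exact (norm_sub_le _ _).trans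
      (add_le_add (hp n) (norm_iterated_integral_le (fun s => hC _ _) ht).2)
  obtain ⟨z, hz, φ, hφ, hlim⟩ := exists_subseq_tendsto_of_lipschitz hbound hlip
  have hgz : Continuous fun s => F s (z s) := hF.comp (continuous_id.prodMk hz)
  have hdelay : Tendsto (fun n => (1 : ℝ) / ((φ n : ℕ) + 1)) atTop (𝓝 0) :=
    (tendsto_one_div_add_atTop_nhds_zero_nat (𝕜 := ℝ)).comp hφ.tendsto_atTop
  have hlim' : ∀ s ∈ Icc (0 : ℝ) 1,
      Tendsto (fun n => u (φ n) (max (s - 1 / ((φ n : ℕ) + 1)) 0)) atTop (𝓝 (z s)) := by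
    intro s hs
    refine (hlim s hs).congr_dist (squeeze_zero (fun _ => dist_nonneg) (fun n => ?_)
      (mul_zero C ▸ hdelay.const_mul C))
    have hpos : (0 : ℝ) < 1 / ((φ n : ℕ) + 1) := by positivity
    have hmem : max (s - 1 / ((φ n : ℕ) + 1)) 0 ∈ Icc (0 : ℝ) 1 :=
      ⟨le_max_right _ _, max_le (by linarith [hs.2]) zero_le_one⟩
    set d : ℝ := 1 / ((φ n : ℕ) + 1)
    rw [dist_eq_norm]
    refine (hlip _ s hs _ hmem).trans (mul_le_mul_of_nonneg_left ?_ hC0)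
    rw [abs_of_nonneg (sub_nonneg.2 (max_le (by linarith) hs.1))]
    linarith [le_max_left (s - d) 0]
  have hinner : ∀ r ∈ Icc (0 : ℝ) 1,
      Tendsto (fun n => ∫ s in 0..r, F s (u (φ n) (max (s - 1 / ((φ n : ℕ) + 1)) 0))) atTop
        (𝓝 (∫ s in 0..r, F s (z s))) := by
    intro r hr
    refine intervalIntegral.tendsto_integral_filter_of_dominated_convergence (fun _ => C)
      (Eventually.of_forall fun n => (hgcont _).aestronglyMeasurable)
      (Eventually.of_forall fun n => Eventually.of_forall fun s _ => hC _ _)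
      intervalIntegrable_const (Eventually.of_forall fun s hs => ?_)
    rw [uIoc_of_le hr.1] at hs
    exact (hF.tendsto (s, z s)).comp
      (tendsto_const_nhds.prodMk_nhds (hlim' s ⟨hs.1.le, hs.2.trans hr.2⟩))
  have houter : ∀ t ∈ Icc (0 : ℝ) 1,
      Tendsto (fun n => ∫ r in 0..t, ∫ s in 0..r,
        F s (u (φ n) (max (s - 1 / ((φ n : ℕ) + 1)) 0))) atTop
        (𝓝 (∫ r in 0..t, ∫ s in 0..r, F s (z s))) := by
    intro t ht
    refine intervalIntegral.tendsto_integral_filter_of_dominated_convergence (fun _ => C)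
      (Eventually.of_forall fun n => (intervalIntegral.continuous_primitive
        (fun a b => (hgcont _).intervalIntegrable a b) 0).aestronglyMeasurable)
      (Eventually.of_forall fun n => Eventually.of_forall fun r hr => ?_)
      intervalIntegrable_const (Eventually.of_forall fun r hr => ?_) <;>
    rw [uIoc_of_le ht.1] at hr
    · exact (norm_iterated_integral_le (fun s => hC _ _) ⟨hr.1.le, hr.2.trans ht.2⟩).1
    · exact hinner r ⟨hr.1.le, hr.2.trans ht.2⟩
  have h0 : (0 : ℝ) ∈ Icc (0 : ℝ) 1 := ⟨le_rfl, zero_le_one⟩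
  have h1 : (1 : ℝ) ∈ Icc (0 : ℝ) 1 := ⟨zero_le_one, le_rfl⟩
  have hpu : ∀ n, p n = u n 0 := fun n => by rw [hu n 0 h0]; simp
  have heq : ∀ t ∈ Icc (0 : ℝ) 1, z t = z 0 - ∫ r in 0..t, ∫ s in 0..r, F s (z s) := by
    intro t ht
    refine tendsto_nhds_unique (hlim t ht) (((hlim 0 h0).sub (houter t ht)).congr fun n => ?_)
    rw [hu _ t ht, hpu]
  refine ⟨_, _, fun s => F s (z s), hgz, hasDerivAt_sub_iterated_integral hgz (z 0),
    fun t => (hgz.integral_hasStrictDerivAt 0 t).hasDerivAt.neg, fun t ht => ?_, by simp, ?_⟩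
  · simp only
    rw [← heq t ht]
  · rw [← heq 1 h1]
    exact tendsto_nhds_unique (hlim 1 h1) (by simp [hu1])

theorem antitoneOn_of_hasDerivAt_nonpos {w w' : ℝ → ℝ} (hw : ∀ t, HasDerivAt w (w' t) t)
    (h : ∀ t ∈ Icc (0 : ℝ) 1, w' t ≤ 0) : AntitoneOn w (Icc 0 1) :=
  antitoneOn_of_deriv_nonpos (convex_Icc 0 1) (fun t _ => (hw t).continuousAt.continuousWithinAt)
    (fun t _ => (hw t).differentiableAt.differentiableWithinAt)
    fun t ht => (hw t).deriv ▸ h t (interior_subset ht)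

theorem antitoneOn_of_deriv2_nonpos {w w' w'' : ℝ → ℝ} (hw : ∀ t, HasDerivAt w (w' t) t)
    (hw' : ∀ t, HasDerivAt w' (w'' t) t) (h : ∀ t ∈ Icc (0 : ℝ) 1, w'' t ≤ 0) (h0 : w' 0 ≤ 0) :
    AntitoneOn w (Icc 0 1) :=
  antitoneOn_of_hasDerivAt_nonpos hw fun _ ht =>
    (antitoneOn_of_hasDerivAt_nonpos hw' h ⟨le_rfl, zero_le_one⟩ ht ht.1).trans h0

theorem hasDerivAt_mul_cos (A ω t : ℝ) :
    HasDerivAt (fun t => A * cos (ω * t)) (-(A * ω) * sin (ω * t)) t := by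
  have h := ((hasDerivAt_const_mul ω (x := t)).cos).const_mul A
  exact h.congr_deriv (by ring)

theorem hasDerivAt_mul_sin (A ω t : ℝ) :
    HasDerivAt (fun t => A * sin (ω * t)) (A * ω * cos (ω * t)) t := by
  have h := ((hasDerivAt_const_mul ω (x := t)).sin).const_mul A
  exact h.congr_deriv (by ring)

/-- Ordered lower and upper barriers: solutions of the problem truncated between them satisfy the
corresponding bounds. -/
theorem exists_barriers {f : ℝ → ℝ → ℝ → ℝ}
    (hpos : ∀ t ∈ Icc (0 : ℝ) 1, ∀ u, 0 ≤ u → ∀ v, 0 ≤ v → 0 ≤ f t u v)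
    (hH : ∀ M > 0, ∃ C > 0, ∀ t ∈ Icc (0 : ℝ) 1, ∀ u ∈ Icc (0 : ℝ) M, ∀ v, 0 ≤ v → f t u v ≤ C)
    (h0 : ∃ ε > 0, ∃ δ > 0, ∀ t ∈ Icc (0 : ℝ) 1, ∀ u ∈ Icc (0 : ℝ) δ, ∀ v, 0 ≤ v →
      (π ^ 2 / 4 + ε) * u ≤ f t u v)
    (hinf : ∃ ε ∈ Ioo (0 : ℝ) (π ^ 2 / 4), ∃ M > 0, ∀ t ∈ Icc (0 : ℝ) 1, ∀ u, M ≤ u → ∀ v, 0 ≤ v →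
      f t u v ≤ (π ^ 2 / 4 - ε) * u) :
    ∃ lo hi : ℝ → ℝ, Continuous lo ∧ Continuous hi ∧
      (∀ t ∈ Icc (0 : ℝ) 1, 0 ≤ lo t ∧ lo t ≤ hi t) ∧ 0 < lo 0 ∧
      ∀ x x' g v : ℝ → ℝ, (∀ t, HasDerivAt x (x' t) t) → (∀ t, HasDerivAt x' (-g t) t) →
        x' 0 = 0 → x 1 = 0 → (∀ t ∈ Icc (0 : ℝ) 1, 0 ≤ v t) →
        (∀ t ∈ Icc (0 : ℝ) 1, g t = f t (max (lo t) (min (x t) (hi t))) (v t)) →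
        ∀ t ∈ Icc (0 : ℝ) 1, lo t ≤ x t ∧ x t ≤ hi t := by
  obtain ⟨ε, hε, δ, hδ, h0⟩ := h0
  obtain ⟨ε', ⟨hε', hε'μ⟩, M, hM, hinf⟩ := hinf
  obtain ⟨C, hC, hH⟩ := hH M hM
  have hπ := pi_pos
  obtain ⟨ω, hω, hω2⟩ : ∃ ω > 0, ω ^ 2 = π ^ 2 / 4 - ε' :=
    ⟨√(π ^ 2 / 4 - ε'), sqrt_pos.2 (by linarith), sq_sqrt (by linarith)⟩
  have hωπ : ω < π / 2 := by nlinarith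
  have hgrowth : ∀ t ∈ Icc (0 : ℝ) 1, ∀ u, 0 ≤ u → ∀ v, 0 ≤ v → f t u v ≤ ω ^ 2 * u + C := by
    intro t ht u hu v hv
    rcases le_total u M with h | h
    · have := hH t ht u ⟨hu, h⟩ v hv
      nlinarith [mul_nonneg (sq_nonneg ω) hu]
    · have := hinf t ht u h v hv
      rw [hω2]
      linarith
  have hcosω : 0 < cos ω := cos_pos_of_mem_Ioo ⟨by linarith, hωπ⟩
  obtain ⟨c, hc, hcδ⟩ : ∃ c > 0, c * (π / 2) = δ := ⟨δ / (π / 2), by positivity, by field_simp⟩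
  have hcδ' : c ≤ δ := by nlinarith [pi_gt_three]
  obtain ⟨K, hK, hKC⟩ : ∃ K > 0, ω ^ 2 * K = C := ⟨C / ω ^ 2, by positivity, by field_simp⟩
  obtain ⟨A, hA, hAK⟩ : ∃ A > 0, A * cos ω = c + K :=
    ⟨(c + K) / cos ω, by positivity, by field_simp⟩
  have hlohi : ∀ t ∈ Icc (0 : ℝ) 1,
      0 ≤ c * cos (π / 2 * t) ∧ c * cos (π / 2 * t) ≤ A * cos (ω * t) - K := by
    intro t ht
    have h1 : 0 ≤ cos (π / 2 * t) :=
      cos_nonneg_of_neg_pi_div_two_le_of_le (by nlinarith [ht.1]) (by nlinarith [ht.2])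
    have h2 : cos ω ≤ cos (ω * t) :=
      cos_le_cos_of_nonneg_of_le_pi (mul_nonneg hω.le ht.1) (by linarith)
        (mul_le_of_le_one_right hω.le ht.2)
    have h3 := cos_le_one (π / 2 * t)
    exact ⟨by positivity, by nlinarith⟩
  refine ⟨fun t => c * cos (π / 2 * t), fun t => A * cos (ω * t) - K, by fun_prop, by fun_prop,
    hlohi, by simpa using hc, fun x x' g v hx hx' hx'0 hx1 hv hg => ?_⟩
  let m : ℝ → ℝ := fun t => max (c * cos (π / 2 * t)) (min (x t) (A * cos (ω * t) - K))
  have hg : ∀ t ∈ Icc (0 : ℝ) 1, g t = f t (m t) (v t) := hg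
  have hlom : ∀ t, c * cos (π / 2 * t) ≤ m t := fun t => le_max_left _ _
  have hm0 : ∀ t ∈ Icc (0 : ℝ) 1, 0 ≤ m t := fun t ht => (hlohi t ht).1.trans (hlom t)
  have hg0 : ∀ t ∈ Icc (0 : ℝ) 1, 0 ≤ g t := fun t ht =>
    hg t ht ▸ hpos t ht _ (hm0 t ht) _ (hv t ht)
  have h0mem : (0 : ℝ) ∈ Icc (0 : ℝ) 1 := ⟨le_rfl, zero_le_one⟩
  have h1mem : (1 : ℝ) ∈ Icc (0 : ℝ) 1 := ⟨zero_le_one, le_rfl⟩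
  intro t ht
  constructor
  · rcases le_or_gt (x 0) δ with hxδ | hxδ
    · have hanti : AntitoneOn x (Icc 0 1) :=
        antitoneOn_of_deriv2_nonpos hx hx' (fun s hs => neg_nonpos.2 (hg0 s hs)) hx'0.le
      have hw := antitoneOn_of_deriv2_nonpos
        (fun s => (hx s).sub (hasDerivAt_mul_cos c (π / 2) s))
        (fun s => (hx' s).sub (hasDerivAt_mul_sin (-(c * (π / 2))) (π / 2) s))
        (fun s hs => by
          have hmδ : m s ≤ δ := max_le
            ((mul_le_of_le_one_right hc.le (cos_le_one _)).trans hcδ')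
            ((min_le_left _ _).trans ((hanti h0mem hs hs.1).trans hxδ))
          have h := h0 s hs (m s) ⟨hm0 s hs, hmδ⟩ (v s) (hv s hs)
          rw [← hg s hs] at h
          nlinarith [hlom s, hm0 s hs, mul_le_mul_of_nonneg_left (hlom s) (sq_nonneg π)])
        (by simp [hx'0]) ht h1mem ht.2
      simpa [hx1] using hw
    · have hconc : ConcaveOn ℝ (Icc 0 1) x := by
        refine AntitoneOn.concaveOn_of_deriv (convex_Icc 0 1)
          (fun s _ => (hx s).continuousAt.continuousWithinAt)
          (fun s _ => (hx s).differentiableAt.differentiableWithinAt) ?_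
        rw [funext fun s => (hx s).deriv]
        exact (antitoneOn_of_hasDerivAt_nonpos hx'
          fun s hs => neg_nonpos.2 (hg0 s hs)).mono interior_subset
      have h := hconc.2 h0mem h1mem (sub_nonneg.2 ht.2) ht.1 (sub_add_cancel 1 t)
      simp only [smul_eq_mul, mul_zero, mul_one, zero_add, hx1, add_zero] at h
      have hcos : cos (π / 2 * t) ≤ π / 2 * (1 - t) := by
        rw [← sin_pi_div_two_sub]
        refine (sin_le (by nlinarith [ht.2])).trans (by linarith)
      nlinarith [ht.2]
  · have hw := antitoneOn_of_deriv2_nonpos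
      (fun s => ((hasDerivAt_mul_cos A ω s).sub_const K).sub (hx s))
      (fun s => (hasDerivAt_mul_sin (-(A * ω)) ω s).sub (hx' s))
      (fun s hs => by
        have hmhi : m s ≤ A * cos (ω * s) - K := max_le (hlohi s hs).2 (min_le_right _ _)
        have h := hgrowth s hs (m s) (hm0 s hs) (v s) (hv s hs)
        rw [← hg s hs] at h
        nlinarith [mul_le_mul_of_nonneg_left hmhi (sq_nonneg ω)])
      (by simp [hx'0]) ht h1mem ht.2
    simp only [Pi.sub_apply, mul_one, hx1, hAK] at hw
    linarith

/-- Regularity and boundary data of a function given with its first two derivatives. -/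
theorem contDiffOn_and_iteratedDerivWithin_eq {x x' g : ℝ → ℝ} (hg : Continuous g)
    (hx : ∀ t, HasDerivAt x (x' t) t) (hx' : ∀ t, HasDerivAt x' (-g t) t) :
    ContDiffOn ℝ 2 x (Icc 0 1) ∧
      (∀ t ∈ Icc (0 : ℝ) 1, iteratedDerivWithin 2 x (Icc 0 1) t = -g t) ∧
      derivWithin x (Icc 0 1) 0 = x' 0 := by
  have hd : deriv x = x' := funext fun t => (hx t).deriv
  have hd' : deriv x' = fun t => -g t := funext fun t => (hx' t).deriv
  have hcd1 : ContDiff ℝ 1 x' :=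
    contDiff_one_iff_deriv.2 ⟨fun t => (hx' t).differentiableAt, by rw [hd']; fun_prop⟩
  have hcd : ContDiff ℝ 2 x := by
    rw [show (2 : WithTop ℕ∞) = 1 + 1 by norm_num, contDiff_succ_iff_deriv]
    exact ⟨fun t => (hx t).differentiableAt, by simp, by rwa [hd]⟩
  have hud : UniqueDiffOn ℝ (Icc (0 : ℝ) 1) := uniqueDiffOn_Icc zero_lt_one
  refine ⟨hcd.contDiffOn, fun t ht => ?_,
    (hx 0).hasDerivWithinAt.derivWithin (hud 0 ⟨le_rfl, zero_le_one⟩)⟩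
  rw [iteratedDerivWithin_eq_iteratedDeriv hud hcd.contDiffAt ht, iteratedDeriv_succ',
    iteratedDeriv_one, hd, hd']

theorem continuous_comp_truncation {f : ℝ → ℝ → ℝ → ℝ}
    (hc : ContinuousOn (fun p : ℝ × ℝ × ℝ => f p.1 p.2.1 p.2.2) (Icc 0 1 ×ˢ Ici 0 ×ˢ Ici 0))
    {X : Type*} [TopologicalSpace X] {τ a b : X → ℝ} (hτ : Continuous τ) (ha : Continuous a)
    (hb : Continuous b) (hτ' : ∀ p, τ p ∈ Icc (0 : ℝ) 1) {B : ℝ} (ha' : ∀ p, a p ∈ Icc 0 B)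
    (hb' : ∀ p, b p ∈ Icc 0 B) :
    Continuous (fun p => f (τ p) (a p) (b p)) ∧ ∃ C, ∀ p, ‖f (τ p) (a p) (b p)‖ ≤ C := by
  refine ⟨hc.comp_continuous (hτ.prodMk (ha.prodMk hb))
    fun p => ⟨hτ' p, (ha' p).1, (hb' p).1⟩, ?_⟩
  have hsub : Icc (0 : ℝ) 1 ×ˢ Icc 0 B ×ˢ Icc 0 B ⊆ Icc (0 : ℝ) 1 ×ˢ Ici 0 ×ˢ Ici 0 :=
    prod_mono le_rfl (prod_mono Icc_subset_Ici_self Icc_subset_Ici_self)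
  obtain ⟨C, hC⟩ := (isCompact_Icc.prod
    (isCompact_Icc.prod isCompact_Icc)).exists_bound_of_continuousOn (hc.mono hsub)
  exact ⟨C, fun p => hC (τ p, a p, b p) ⟨hτ' p, ha' p, hb' p⟩⟩

theorem coexistence_positive_solution_eigenvalue_criteria
    (f₁ f₂ : ℝ → ℝ → ℝ → ℝ)
    (hc₁ : ContinuousOn (fun p : ℝ × ℝ × ℝ => f₁ p.1 p.2.1 p.2.2)
      (Set.Icc 0 1 ×ˢ Set.Ici 0 ×ˢ Set.Ici 0))
    (hc₂ : ContinuousOn (fun p : ℝ × ℝ × ℝ => f₂ p.1 p.2.1 p.2.2)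
      (Set.Icc 0 1 ×ˢ Set.Ici 0 ×ˢ Set.Ici 0))
    (hpos₁ : ∀ t ∈ Set.Icc (0:ℝ) 1, ∀ u ∈ Set.Ici (0:ℝ), ∀ v ∈ Set.Ici (0:ℝ),
      0 ≤ f₁ t u v)
    (hpos₂ : ∀ t ∈ Set.Icc (0:ℝ) 1, ∀ u ∈ Set.Ici (0:ℝ), ∀ v ∈ Set.Ici (0:ℝ),
      0 ≤ f₂ t u v)
    (hH₁ : ∀ M > 0, ∃ C > 0, ∀ t ∈ Set.Icc (0:ℝ) 1, ∀ u ∈ Set.Icc (0:ℝ) M,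
      ∀ v ∈ Set.Ici (0:ℝ), f₁ t u v ≤ C)
    (hH₂ : ∀ M > 0, ∃ C > 0, ∀ t ∈ Set.Icc (0:ℝ) 1, ∀ u ∈ Set.Ici (0:ℝ),
      ∀ v ∈ Set.Icc (0:ℝ) M, f₂ t u v ≤ C)
    (h0₁ : ∃ ε > 0, ∃ δ > 0, ∀ t ∈ Set.Icc (0:ℝ) 1, ∀ u ∈ Set.Icc (0:ℝ) δ,
      ∀ v ∈ Set.Ici (0:ℝ), (π ^ 2 / 4 + ε) * u ≤ f₁ t u v)
    (h0₂ : ∃ ε > 0, ∃ δ > 0, ∀ t ∈ Set.Icc (0:ℝ) 1, ∀ u ∈ Set.Ici (0:ℝ),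
      ∀ v ∈ Set.Icc (0:ℝ) δ, (π ^ 2 / 4 + ε) * v ≤ f₂ t u v)
    (hinf₁ : ∃ ε ∈ Set.Ioo (0:ℝ) (π ^ 2 / 4), ∃ M > 0, ∀ t ∈ Set.Icc (0:ℝ) 1,
      ∀ u ∈ Set.Ici M, ∀ v ∈ Set.Ici (0:ℝ), f₁ t u v ≤ (π ^ 2 / 4 - ε) * u)
    (hinf₂ : ∃ ε ∈ Set.Ioo (0:ℝ) (π ^ 2 / 4), ∃ M > 0, ∀ t ∈ Set.Icc (0:ℝ) 1,
      ∀ u ∈ Set.Ici (0:ℝ), ∀ v ∈ Set.Ici M, f₂ t u v ≤ (π ^ 2 / 4 - ε) * v) :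
    ∃ x y : ℝ → ℝ,
      ContDiffOn ℝ 2 x (Set.Icc 0 1) ∧ ContDiffOn ℝ 2 y (Set.Icc 0 1) ∧
      (∀ t ∈ Set.Icc (0:ℝ) 1, 0 ≤ x t) ∧ (∀ t ∈ Set.Icc (0:ℝ) 1, 0 ≤ y t) ∧
      (∃ t ∈ Set.Icc (0:ℝ) 1, x t ≠ 0) ∧ (∃ t ∈ Set.Icc (0:ℝ) 1, y t ≠ 0) ∧
      (∀ t ∈ Set.Icc (0:ℝ) 1,
        iteratedDerivWithin 2 x (Set.Icc 0 1) t + f₁ t (x t) (y t) = 0) ∧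
      (∀ t ∈ Set.Icc (0:ℝ) 1,
        iteratedDerivWithin 2 y (Set.Icc 0 1) t + f₂ t (x t) (y t) = 0) ∧
      derivWithin x (Set.Icc 0 1) 0 = 0 ∧ x 1 = 0 ∧
      derivWithin y (Set.Icc 0 1) 0 = 0 ∧ y 1 = 0 := by
  obtain ⟨lo₁, hi₁, hlo₁, hhi₁, hord₁, hlo₁0, hbar₁⟩ :=
    exists_barriers (f := f₁) hpos₁ hH₁ h0₁ hinf₁
  obtain ⟨lo₂, hi₂, hlo₂, hhi₂, hord₂, hlo₂0, hbar₂⟩ :=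
    exists_barriers (f := fun t u v => f₂ t v u)
      (fun t ht u hu v hv => hpos₂ t ht v hv u hu)
      (fun M hM => (hH₂ M hM).imp fun C hC =>
        ⟨hC.1, fun t ht u hu v hv => hC.2 t ht v hv u hu⟩)
      (by
        obtain ⟨ε, hε, δ, hδ, h⟩ := h0₂
        exact ⟨ε, hε, δ, hδ, fun t ht u hu v hv => h t ht v hv u hu⟩)
      (by
        obtain ⟨ε, hε, M, hM, h⟩ := hinf₂
        exact ⟨ε, hε, M, hM, fun t ht u hu v hv => h t ht v hv u hu⟩)
  obtain ⟨B₁, hB₁⟩ := isCompact_Icc.exists_bound_of_continuousOn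
    (hhi₁.continuousOn (s := Icc (0 : ℝ) 1))
  obtain ⟨B₂, hB₂⟩ := isCompact_Icc.exists_bound_of_continuousOn
    (hhi₂.continuousOn (s := Icc (0 : ℝ) 1))
  let τ : ℝ → ℝ := fun t => max 0 (min t 1)
  have hτ : ∀ t, τ t ∈ Icc (0 : ℝ) 1 := fun t =>
    ⟨le_max_left _ _, max_le zero_le_one (min_le_right _ _)⟩
  have hτ_eq : ∀ t ∈ Icc (0 : ℝ) 1, τ t = t := fun t ht => by simp [τ, ht.1, ht.2]
  have hτc : Continuous τ := by fun_prop
  let a : ℝ → ℝ → ℝ := fun t u => max (lo₁ t) (min u (hi₁ t))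
  let b : ℝ → ℝ → ℝ := fun t u => max (lo₂ t) (min u (hi₂ t))
  have ha : ∀ t ∈ Icc (0 : ℝ) 1, ∀ u, a t u ∈ Icc 0 (max B₁ B₂) := fun t ht u =>
    ⟨(hord₁ t ht).1.trans (le_max_left _ _),
      (max_le (hord₁ t ht).2 (min_le_right _ _)).trans
        (((le_abs_self _).trans (hB₁ t ht)).trans (le_max_left _ _))⟩
  have hb : ∀ t ∈ Icc (0 : ℝ) 1, ∀ u, b t u ∈ Icc 0 (max B₁ B₂) := fun t ht u =>
    ⟨(hord₂ t ht).1.trans (le_max_left _ _),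
      (max_le (hord₂ t ht).2 (min_le_right _ _)).trans
        (((le_abs_self _).trans (hB₂ t ht)).trans (le_max_right _ _))⟩
  have hac : Continuous fun q : ℝ × ℝ × ℝ => a (τ q.1) q.2.1 := by fun_prop
  have hbc : Continuous fun q : ℝ × ℝ × ℝ => b (τ q.1) q.2.2 := by fun_prop
  have hτc' : Continuous fun q : ℝ × ℝ × ℝ => τ q.1 := by fun_prop
  obtain ⟨hF₁, C₁, hC₁⟩ := continuous_comp_truncation hc₁ hτc' hac hbc (fun q => hτ q.1)
    (fun q => ha _ (hτ q.1) q.2.1) (fun q => hb _ (hτ q.1) q.2.2)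
  obtain ⟨hF₂, C₂, hC₂⟩ := continuous_comp_truncation hc₂ hτc' hac hbc (fun q => hτ q.1)
    (fun q => ha _ (hτ q.1) q.2.1) (fun q => hb _ (hτ q.1) q.2.2)
  obtain ⟨z, z', g, hg, hz, hz', hgF, hz'0, hz1⟩ := exists_neumann_dirichlet_solution
    (F := fun t z => (f₁ (τ t) (a (τ t) z.1) (b (τ t) z.2),
      f₂ (τ t) (a (τ t) z.1) (b (τ t) z.2))) (C := max C₁ C₂) (hF₁.prodMk hF₂)
    (fun t z => max_le_max (hC₁ (t, z)) (hC₂ (t, z)))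
  have hx : ∀ t, HasDerivAt (fun t => (z t).1) (z' t).1 t := fun t => (hz t).fst
  have hx' : ∀ t, HasDerivAt (fun t => (z' t).1) (-(g t).1) t := fun t => (hz' t).fst
  have hy : ∀ t, HasDerivAt (fun t => (z t).2) (z' t).2 t := fun t => (hz t).snd
  have hy' : ∀ t, HasDerivAt (fun t => (z' t).2) (-(g t).2) t := fun t => (hz' t).snd
  have hg₁ : ∀ t ∈ Icc (0 : ℝ) 1, (g t).1 = f₁ t (a t (z t).1) (b t (z t).2) :=
    fun t ht => by rw [hgF t ht, hτ_eq t ht]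
  have hg₂ : ∀ t ∈ Icc (0 : ℝ) 1, (g t).2 = f₂ t (a t (z t).1) (b t (z t).2) :=
    fun t ht => by rw [hgF t ht, hτ_eq t ht]
  have hxb := hbar₁ _ _ _ (fun t => b t (z t).2) hx hx' (by simp [hz'0]) (by simp [hz1])
    (fun t ht => (hb t ht _).1) hg₁
  have hyb := hbar₂ _ _ _ (fun t => a t (z t).1) hy hy' (by simp [hz'0]) (by simp [hz1])
    (fun t ht => (ha t ht _).1) hg₂
  have ha_eq : ∀ t ∈ Icc (0 : ℝ) 1, a t (z t).1 = (z t).1 := fun t ht => by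
    simp only [a, min_eq_left (hxb t ht).2, max_eq_right (hxb t ht).1]
  have hb_eq : ∀ t ∈ Icc (0 : ℝ) 1, b t (z t).2 = (z t).2 := fun t ht => by
    simp only [b, min_eq_left (hyb t ht).2, max_eq_right (hyb t ht).1]
  obtain ⟨hxC, hxd, hx0⟩ := contDiffOn_and_iteratedDerivWithin_eq hg.fst hx hx'
  obtain ⟨hyC, hyd, hy0⟩ := contDiffOn_and_iteratedDerivWithin_eq hg.snd hy hy'
  have h0 : (0 : ℝ) ∈ Icc (0 : ℝ) 1 := ⟨le_rfl, zero_le_one⟩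
  refine ⟨fun t => (z t).1, fun t => (z t).2, hxC, hyC,
    fun t ht => (hord₁ t ht).1.trans (hxb t ht).1, fun t ht => (hord₂ t ht).1.trans (hyb t ht).1,
    ⟨0, h0, (hlo₁0.trans_le (hxb 0 h0).1).ne'⟩, ⟨0, h0, (hlo₂0.trans_le (hyb 0 h0).1).ne'⟩,
    fun t ht => ?_, fun t ht => ?_, by simp [hx0, hz'0], by simp [hz1], by simp [hy0, hz'0],
    by simp [hz1]⟩
  · rw [hxd t ht, hg₁ t ht, ha_eq t ht, hb_eq t ht, neg_add_cancel]
  · rw [hyd t ht, hg₂ t ht, ha_eq t ht, hb_eq t ht, neg_add_cancel]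
end
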